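/- arXiv:1401.6387 — 2 statements merged into one kernel-verified Lean document; each statement's English description precedes it below -/
import Mathlib

section
/- s(23) = 13: the minimum number of squares in a squared tiling of the 23×23 square by strictly smaller integer squares equals 13. -/
/-- A squared tiling of the `n × n` square: a finite set of triples `(x, y, h)`
representing an `h × h` square with upper-left corner at cell `(x, y)`,
where `1 ≤ h ≤ n - 1`, the square lies inside the board, and every cell
`(i, j)` with `i, j < n` is covered by exactly one square of the tiling. -/
def IsSquaredTiling (n : ℕ) (T : Finset (ℕ × ℕ × ℕ)) : Prop :=
  (∀ t ∈ T, 1 ≤ t.2.2 ∧ t.2.2 ≤ n - 1 ∧ t.1 + t.2.2 ≤ n ∧ t.2.1 + t.2.2 ≤ n) ∧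
  (∀ i j : ℕ, i < n → j < n →
    ∃! t : ℕ × ℕ × ℕ, t ∈ T ∧
      t.1 ≤ i ∧ i < t.1 + t.2.2 ∧ t.2.1 ≤ j ∧ j < t.2.1 + t.2.2)

/-- `s n` is the minimum number of squares in a squared tiling of the
`n × n` square. -/
noncomputable def s (n : ℕ) : ℕ :=
  sInf {k | ∃ T : Finset (ℕ × ℕ × ℕ), IsSquaredTiling n T ∧ T.card = k}

/-! ## The search -/

/-- A skyline: a list of segments (height, width). -/
inductive Sk where
  | nil : Sk
  | cons (h w : ℕ) (t : Sk) : Sk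

namespace Sk

/-- lower bound for the number of squares resting on a segment -/
noncomputable def wt (h w : ℕ) : ℕ := Nat.div (Nat.add w (Nat.sub 22 h)) (Nat.sub 23 h)

noncomputable def lw (q : Sk) : ℕ :=
  @Sk.rec (fun _ => ℕ) 0 (fun h w _ ih => Nat.add (wt h w) ih) q

/-- evaluate the number before passing it on -/
noncomputable def force (x : ℕ) (K : ℕ → Bool) : Bool :=
  @Nat.rec (fun _ => Bool) (K 0) (fun n _ => K (Nat.succ n)) x

/-- inner loop of `cnt`: pop the lower entries of the stack -/
noncomputable def cnt (K : ℕ → Bool) (rs : Sk) : Sk → ℕ → Bool :=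
  @Sk.rec (fun _ => Sk → ℕ → Bool)
    (fun _ b => K b)
    (fun h w _ ih st b =>
      @Sk.rec (fun _ => Bool) false
        (fun h' w' t ih2 =>
          @Bool.rec (fun _ => Bool)
            ih2
            (@Bool.rec (fun _ => Bool)
              (@Bool.rec (fun _ => Bool) true
                (ih (Sk.cons h w (Sk.cons h' w' t)) (Nat.sub b (wt h w)))
                (Nat.ble (wt h w) b))
              (ih (Sk.cons h' w' t) b)
              (Nat.beq h' h))
            (Nat.ble h h')) st) rs

/-- find the leftmost valley -/
noncomputable def scan (V : Sk → ℕ → ℕ → Sk → Bool) (rs : Sk) : Sk → ℕ → ℕ → Bool :=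
  @Sk.rec (fun _ => Sk → ℕ → ℕ → Bool)
    (fun ls h w => @Bool.rec (fun _ => Bool) (V ls h w Sk.nil) false (Nat.beq h 23))
    (fun h' w' t ih ls h w =>
      @Bool.rec (fun _ => Bool)
        (ih (Sk.cons h w ls) h' w')
        (@Bool.rec (fun _ => Bool)
          (V ls h w (Sk.cons h' w' t))
          (force (Nat.add w w') (fun w2 => ih ls h w2))
          (Nat.beq h' h))
        (Nat.ble h h')) rs

/-- continue after the valley has been filled by one square -/
noncomputable def fill (V : Sk → ℕ → ℕ → Sk → Bool) (ls : Sk) (h w : ℕ) (rs : Sk) : Bool :=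
  @Sk.rec (fun _ => Bool) false
    (fun h' w' t _ =>
      @Bool.rec (fun _ => Bool)
        (V t h' w' (Sk.cons h w rs))
        (@Bool.rec (fun _ => Bool)
          (scan V rs (Sk.cons h' w' t) h w)
          (force (Nat.add w w') (fun w2 => scan V rs t h w2))
          (Nat.beq h' h))
        (Nat.ble h h')) ls

/-- place a square narrower than the valley at its right end -/
noncomputable def split (V : Sk → ℕ → ℕ → Sk → Bool) (ls : Sk) (h w : ℕ) (rs : Sk) : Bool :=
  @Nat.rec (fun _ => Bool) true
    (fun k ih => @Bool.rec (fun _ => Bool) false ih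
       (@Bool.rec (fun _ => Bool) true
         (force (Nat.sub w (Nat.succ k)) (fun w' => force (Nat.add h (Nat.succ k)) (fun h' =>
           V ls h w' (Sk.cons h' (Nat.succ k) rs))))
         (Nat.ble (Nat.add h (Nat.succ k)) 23)))
    (Nat.sub w 1)

noncomputable def node (V : Sk → ℕ → ℕ → Sk → Bool) (ls : Sk) (h w : ℕ) (rs : Sk)
    (sl : ℕ) : Bool :=
  @Bool.rec (fun _ => Bool)
    (split V ls h w rs)
    (@Bool.rec (fun _ => Bool) false
      (@Nat.rec (fun _ => Bool) true (fun _ _ => split V ls h w rs) sl)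
      (force (Nat.add h w) (fun h' => fill V ls h' w rs)))
    (Nat.ble (Nat.add h w) 23)

noncomputable def valley (r : ℕ) : Sk → ℕ → ℕ → Sk → Bool :=
  @Nat.rec (fun _ => Sk → ℕ → ℕ → Sk → Bool)
    (fun _ _ _ _ => true)
    (fun r V ls h w rs =>
      @Bool.rec (fun _ => Bool) true
       (cnt (node V ls h w rs) rs (Sk.cons h w ls)
         (Nat.sub (Nat.succ r) (lw (Sk.cons h w ls))))
        (Nat.ble (lw (Sk.cons h w ls)) (Nat.succ r))) r

/-- enumerate the bottom row (at most `k` further squares, from right to left) -/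
noncomputable def row (a : ℕ) (k : ℕ) : ℕ → Sk → Bool :=
  @Nat.rec (fun _ => ℕ → Sk → Bool)
    (fun _ _ => true)
    (fun k R w rs =>
      @Bool.rec (fun _ => Bool) false
        (@Nat.rec (fun _ => Bool) true
          (fun z ih => @Bool.rec (fun _ => Bool) false ih
            (R (Nat.sub w (Nat.succ z)) (Sk.cons (Nat.succ z) (Nat.succ z) rs)))
          (Nat.sub w 1))
        (@Bool.rec (fun _ => Bool) true
          (fill (valley (Nat.add k 8)) (Sk.cons 23 0 Sk.nil) w w rs)
          (Nat.ble w a))) k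

noncomputable def start (a : ℕ) : Bool := row a 3 (Nat.sub 23 a) (Sk.cons a a Sk.nil)


theorem start_1 : start 1 = true := by decide +kernel
theorem start_2 : start 2 = true := by decide +kernel
theorem start_3 : start 3 = true := by decide +kernel
theorem start_4 : start 4 = true := by decide +kernel
theorem start_5 : start 5 = true := by decide +kernel
theorem start_6 : start 6 = true := by decide +kernel
theorem start_7 : start 7 = true := by decide +kernel
theorem start_8 : start 8 = true := by decide +kernel
theorem start_9 : start 9 = true := by decide +kernel
theorem start_10 : start 10 = true := by decide +kernel
theorem start_11 : start 11 = true := by decide +kernel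
theorem start_12 : start 12 = true := by decide +kernel
theorem start_13 : start 13 = true := by decide +kernel
theorem start_14 : start 14 = true := by decide +kernel
theorem start_15 : start 15 = true := by decide +kernel
theorem start_16 : start 16 = true := by decide +kernel
theorem start_17 : start 17 = true := by decide +kernel
theorem start_18 : start 18 = true := by decide +kernel
theorem start_19 : start 19 = true := by decide +kernel
theorem start_20 : start 20 = true := by decide +kernel
theorem start_21 : start 21 = true := by decide +kernel
theorem start_22 : start 22 = true := by decide +kernel

theorem start_all (a : ℕ) (h1 : 1 ≤ a) (h2 : a ≤ 22) : start a = true := by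
  interval_cases a
  · exact start_1
  · exact start_2
  · exact start_3
  · exact start_4
  · exact start_5
  · exact start_6
  · exact start_7
  · exact start_8
  · exact start_9
  · exact start_10
  · exact start_11
  · exact start_12
  · exact start_13
  · exact start_14
  · exact start_15
  · exact start_16
  · exact start_17
  · exact start_18
  · exact start_19
  · exact start_20
  · exact start_21
  · exact start_22

theorem force_eq (x : ℕ) (K : ℕ → Bool) : force x K = K x := by cases x <;> rfl

/-! ## Semantics -/

/-- height of the skyline over column `i`; everything beyond the list is full -/
def ht : Sk → ℕ → ℕ
  | nil, _ => 23
  | cons h w t, i => if i < w then h else ht t (i - w)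

/-- prepend a reversed skyline -/
def ra : Sk → Sk → Sk
  | nil, t => t
  | cons h w l, t => ra l (cons h w t)

def wd : Sk → ℕ
  | nil => 0
  | cons _ w l => wd l + w

theorem ht_ra_ge (ls : Sk) : ∀ (t : Sk) (i : ℕ), ht (ra ls t) (wd ls + i) = ht t i := by
  induction ls with
  | nil => intro t i; simp [ra, wd]
  | cons h w l ih =>
    intro t i
    have := ih (cons h w t) (w + i)
    simp only [ra, wd]
    rw [add_assoc, this]
    simp [ht]

theorem ht_ra_lt (ls : Sk) : ∀ (t t' : Sk) (i : ℕ), i < wd ls →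
    ht (ra ls t) i = ht (ra ls t') i := by
  induction ls with
  | nil => intro t t' i hi; simp [wd] at hi
  | cons h w l ih =>
    intro t t' i hi
    simp only [ra, wd] at *
    by_cases h1 : i < wd l
    · exact ih _ _ _ h1
    · obtain ⟨k, rfl⟩ := Nat.exists_eq_add_of_le (not_lt.mp h1)
      rw [ht_ra_ge, ht_ra_ge]
      have : k < w := by omega
      simp [ht, this]

theorem ht_ra_congr (ls t t' : Sk) (h : ∀ i, ht t i = ht t' i) (i : ℕ) :
    ht (ra ls t) i = ht (ra ls t') i := by
  by_cases h1 : i < wd ls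
  · exact ht_ra_lt _ _ _ _ h1
  · obtain ⟨k, rfl⟩ := Nat.exists_eq_add_of_le (not_lt.mp h1)
    rw [ht_ra_ge, ht_ra_ge, h]

def Cov (t : ℕ × ℕ × ℕ) (i j : ℕ) : Prop :=
  t.1 ≤ i ∧ i < t.1 + t.2.2 ∧ t.2.1 ≤ j ∧ j < t.2.1 + t.2.2

def Adm (H : ℕ → ℕ) (t : ℕ × ℕ × ℕ) : Prop :=
  1 ≤ t.2.2 ∧ t.2.1 + t.2.2 ≤ 23 ∧ ∀ k, t.1 ≤ k → k < t.1 + t.2.2 → H k ≤ t.2.1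

/-- `T` tiles the region above the skyline `H`. -/
def Good (H : ℕ → ℕ) (T : Finset (ℕ × ℕ × ℕ)) : Prop :=
  (∀ t ∈ T, Adm H t) ∧
  (∀ i j, H i ≤ j → j < 23 → ∃ t ∈ T, Cov t i j) ∧
  (∀ t ∈ T, ∀ t' ∈ T, ∀ i j, Cov t i j → Cov t' i j → t = t')

theorem Good.congr {H H' : ℕ → ℕ} {T : Finset (ℕ × ℕ × ℕ)} (hg : Good H T)
    (h : ∀ i, H i = H' i) : Good H' T := by
  have : H = H' := funext h
  rwa [← this]

theorem Good.step {H : ℕ → ℕ} {T : Finset (ℕ × ℕ × ℕ)} (hg : Good H T) (p w h : ℕ)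
    (hw : 1 ≤ w) (hh : h < 23) (hseg : ∀ k, p ≤ k → k < p + w → H k = h)
    (hr : h < H (p + w)) (hl : p = 0 ∨ h < H (p - 1)) :
    ∃ z, 1 ≤ z ∧ z ≤ w ∧ h + z ≤ 23 ∧ (p + w - z, h, z) ∈ T ∧
      ∀ H' : ℕ → ℕ, (∀ k, H' k = if p + w - z ≤ k ∧ k < p + w then h + z else H k) →
        Good H' (T.erase (p + w - z, h, z)) := by
  obtain ⟨g1, g2, g3⟩ := hg
  obtain ⟨⟨x, y, z⟩, ht, hc⟩ := g2 (p + w - 1) h (by rw [hseg _ (by omega) (by omega)]) hh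
  obtain ⟨a1, a2, a3⟩ := g1 _ ht
  obtain ⟨c1, c2, c3, c4⟩ := hc
  simp only at *
  have hy : y = h := by
    have := a3 (p + w - 1) c1 c2
    rw [hseg _ (by omega) (by omega)] at this
    omega
  subst hy
  have hx1 : x + z = p + w := by
    by_contra hne
    have := a3 (p + w) (by omega) (by omega)
    omega
  have hx2 : p ≤ x := by
    by_contra hne
    rcases hl with hl | hl
    · omega
    · have := a3 (p - 1) (by omega) (by omega)
      omega
  have hx : x = p + w - z := by omega
  refine ⟨z, a1, by omega, a2, hx ▸ ht, ?_⟩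
  intro H' hH'
  rw [← hx] at *
  refine ⟨?_, ?_, ?_⟩
  · intro t htT
    obtain ⟨hne, htT⟩ := Finset.mem_erase.mp htT
    obtain ⟨b1, b2, b3⟩ := g1 t htT
    refine ⟨b1, b2, ?_⟩
    intro k hk1 hk2
    rw [hH' k]
    split_ifs with hk
    · by_contra hlt
      have := b3 k hk1 hk2
      rw [hseg k (by omega) hk.2] at this
      apply hne
      exact g3 t htT _ ht k t.2.1 ⟨hk1, hk2, le_rfl, by omega⟩
        ⟨hk.1, by simp only; omega, this, by simp only; omega⟩
    · exact b3 k hk1 hk2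
  · intro i j hij hj
    rw [hH' i] at hij
    have hij' : H i ≤ j := by
      split_ifs at hij with hi
      · rw [hseg i (by omega) hi.2]; omega
      · exact hij
    obtain ⟨t, htT, hct⟩ := g2 i j hij' hj
    refine ⟨t, Finset.mem_erase.mpr ⟨?_, htT⟩, hct⟩
    rintro rfl
    obtain ⟨d1, d2, d3, d4⟩ := hct
    simp only at *
    rw [if_pos ⟨d1, by omega⟩] at hij
    omega
  · intro t h1 t' h2
    exact g3 t (Finset.mem_of_mem_erase h1) t' (Finset.mem_of_mem_erase h2)

/-- left stack below height `h`: strictly decreasing towards the valley, ending at height 23 -/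
def SOK : ℕ → Sk → Prop
  | h, nil => h = 23
  | h, cons h' w' t => h < h' ∧ (t = nil ∨ 1 ≤ w') ∧ SOK h' t

def ROK : Sk → Prop
  | nil => True
  | cons h w t => 1 ≤ w ∧ h ≤ 23 ∧ ROK t

def gtop (h : ℕ) : Sk → Prop
  | nil => True
  | cons h' _ _ => h < h'

def smem (j : ℕ) : Sk → Prop
  | nil => False
  | cons h _ t => j = h ∨ smem j t

def Srt : Sk → Prop
  | nil => True
  | cons h _ t => h ≤ 23 ∧ (∀ j, smem j t → h < j) ∧ Srt t

theorem SOK.le (ls : Sk) : ∀ h, SOK h ls → h ≤ 23 := by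
  induction ls with
  | nil => intro h hs; simp [SOK] at hs; omega
  | cons h' w' t ih => intro h hs; have := ih _ hs.2.2; have := hs.1; omega

theorem SOK.gt (ls : Sk) : ∀ h, SOK h ls → ∀ j, smem j ls → h < j := by
  induction ls with
  | nil => intro h _ j hj; exact hj.elim
  | cons h' w' t ih =>
    intro h hs j hj
    rcases hj with rfl | hj
    · exact hs.1
    · exact hs.1.trans (ih _ hs.2.2 j hj)

theorem SOK.srt (ls : Sk) : ∀ h w, SOK h ls → Srt (cons h w ls) := by
  induction ls with
  | nil => intro h w hs; exact ⟨SOK.le _ _ hs, fun j hj => hj.elim, trivial⟩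
  | cons h' w' t ih =>
    intro h w hs
    exact ⟨SOK.le _ _ hs, SOK.gt _ _ hs, ih _ _ hs.2.2⟩

theorem list_step {T : Finset (ℕ × ℕ × ℕ)} {ls rs : Sk} {h w : ℕ}
    (hg : Good (ht (ra ls (cons h w rs))) T) (hs : SOK h ls) (hw : 1 ≤ w) (hh : h < 23)
    (hrs : ROK rs) (hgt : gtop h rs) :
    ∃ z, 1 ≤ z ∧ z ≤ w ∧ h + z ≤ 23 ∧ (wd ls + w - z, h, z) ∈ T ∧
      Good (ht (ra ls (cons h (w - z) (cons (h + z) z rs)))) (T.erase (wd ls + w - z, h, z)) := by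
  have A1 : ∀ k, wd ls ≤ k → k < wd ls + w → ht (ra ls (cons h w rs)) k = h := by
    intro k k1 k2
    obtain ⟨i, rfl⟩ := Nat.exists_eq_add_of_le k1
    rw [ht_ra_ge]
    simp only [ht]
    rw [if_pos (by omega)]
  have A2 : h < ht (ra ls (cons h w rs)) (wd ls + w) := by
    rw [ht_ra_ge]
    simp only [ht, lt_irrefl, if_false, Nat.sub_self]
    cases rs with
    | nil => simpa [ht] using hh
    | cons h' w' t =>
      have := hrs.1
      simp only [ht]
      rw [if_pos (by omega)]
      exact hgt
  have A3 : wd ls = 0 ∨ h < ht (ra ls (cons h w rs)) (wd ls - 1) := by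
    cases ls with
    | nil => left; rfl
    | cons h' w' t =>
      by_cases hw' : w' = 0
      · rcases hs.2.1 with rfl | h1
        · left; simp [wd, hw']
        · omega
      · right
        simp only [ra, wd]
        rw [show wd t + w' - 1 = wd t + (w' - 1) by omega, ht_ra_ge]
        simp only [ht]
        rw [if_pos (by omega)]
        exact hs.1
  obtain ⟨z, h1, h2, h3, h4, h5⟩ := hg.step (wd ls) w h hw hh A1 A2 A3
  refine ⟨z, h1, h2, h3, h4, h5 _ ?_⟩
  intro k
  by_cases hk : k < wd ls
  · rw [if_neg (by omega)]
    exact ht_ra_lt _ _ _ _ hk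
  · obtain ⟨i, rfl⟩ := Nat.exists_eq_add_of_le (not_lt.mp hk)
    rw [ht_ra_ge, ht_ra_ge]
    simp only [ht]
    by_cases e1 : i < w - z
    · rw [if_pos e1, if_neg (by omega), if_pos (by omega)]
    · rw [if_neg e1]
      by_cases e2 : i < w
      · rw [if_pos (by omega), if_pos (by omega)]
      · rw [if_neg (by omega), if_neg (by omega), if_neg e2]
        congr 1; omega

/-! ## Lower bound -/

def Indep (H : ℕ → ℕ) (C : Finset (ℕ × ℕ)) : Prop :=
  (∀ c ∈ C, H c.1 = c.2 ∧ c.2 < 23) ∧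
  ∀ c ∈ C, ∀ c' ∈ C, ∀ t, Adm H t → Cov t c.1 c.2 → Cov t c'.1 c'.2 → c = c'

theorem Indep.card_le {H : ℕ → ℕ} {C : Finset (ℕ × ℕ)} (hC : Indep H C)
    (T : Finset (ℕ × ℕ × ℕ)) (hT : ∀ c ∈ C, ∃ t ∈ T, Adm H t ∧ Cov t c.1 c.2) :
    C.card ≤ T.card := by
  choose! f hf using hT
  apply Finset.card_le_card_of_injOn f
  · intro c hc; exact (hf c hc).1
  · intro c hc c' hc' he
    refine hC.2 c hc c' hc' (f c) (hf c hc).2.1 (hf c hc).2.2 ?_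
    rw [he]; exact (hf c' hc').2.2

def Inv (H : ℕ → ℕ) (q : ℕ) (C : Finset (ℕ × ℕ)) (st : Sk) : Prop :=
  Indep H C ∧ (∀ c ∈ C, c.1 < q) ∧
  ∀ c ∈ C, (∀ k, c.1 ≤ k → k < q → H k ≤ c.2) → smem c.2 st

theorem Inv.skip {H : ℕ → ℕ} {q : ℕ} {C : Finset (ℕ × ℕ)} {st st' : Sk} (hi : Inv H q C st)
    (h w : ℕ) (hw : 1 ≤ w) (hseg : ∀ k, q ≤ k → k < q + w → H k = h)
    (hst : ∀ j, smem j st → h ≤ j → smem j st') : Inv H (q + w) C st' := by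
  refine ⟨hi.1, fun c hc => ?_, fun c hc hv => ?_⟩
  · have := hi.2.1 c hc; omega
  · have hq := hi.2.1 c hc
    have h1 := hv q (by omega) (by omega)
    rw [hseg q le_rfl (by omega)] at h1
    exact hst _ (hi.2.2 c hc (fun k k1 k2 => hv k k1 (by omega))) h1

theorem Inv.push {H : ℕ → ℕ} {q : ℕ} {C : Finset (ℕ × ℕ)} {st st' : Sk} (hi : Inv H q C st)
    (h w : ℕ) (hw : 1 ≤ w) (hh : h < 23) (hseg : ∀ k, q ≤ k → k < q + w → H k = h)
    (hst : ∀ j, smem j st → h ≤ j → smem j st') (hlt : ∀ j, smem j st' → h < j) :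
    ∃ C', (∀ c ∈ C', c.1 < q → c ∈ C) ∧ (∀ c ∈ C', q ≤ c.1 → ∃ t, c.1 = q + t * (23 - h)) ∧
      C'.card = C.card + wt h w ∧ Inv H (q + w) C' (cons h w st') := by
  classical
  have hwt : wt h w = (w + (22 - h)) / (23 - h) := rfl
  have key : ∀ t, t < wt h w → t * (23 - h) < w := by
    intro t htw
    rw [hwt] at htw
    have h1 : (t + 1) * (23 - h) ≤ (w + (22 - h)) / (23 - h) * (23 - h) :=
      Nat.mul_le_mul_right _ htw
    have h2 := Nat.div_mul_le_self (w + (22 - h)) (23 - h)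
    rw [add_mul] at h1
    omega
  have hnew : ∀ c : ℕ × ℕ, c ∈ (Finset.range (wt h w)).image (fun t => (q + t * (23 - h), h)) →
      q ≤ c.1 ∧ c.1 < q + w ∧ c.2 = h ∧ H c.1 = h ∧ ∃ t, c.1 = q + t * (23 - h) := by
    intro c hc
    obtain ⟨t, ht1, rfl⟩ := Finset.mem_image.mp hc
    have := key t (Finset.mem_range.mp ht1)
    exact ⟨by simp, by simp only; omega, rfl, hseg _ (by simp) (by simp only; omega), t, rfl⟩
  have hcross : ∀ c ∈ C, ∀ c' ∈ (Finset.range (wt h w)).image (fun t => (q + t * (23 - h), h)),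
      ∀ t, Adm H t → Cov t c.1 c.2 → Cov t c'.1 c'.2 → False := by
    intro c hc c' hc' t hA h1 h2
    obtain ⟨n1, n2, n3, n4, -⟩ := hnew c' hc'
    obtain ⟨a1, a2, a3⟩ := hA
    obtain ⟨b1, b2, b3, b4⟩ := h1
    obtain ⟨d1, d2, d3, d4⟩ := h2
    have e1 := a3 _ b1 b2
    have e2 := a3 _ d1 d2
    have e3 := (hi.1.1 c hc).1
    have hcq := hi.2.1 c hc
    have hch : c.2 = h := by omega
    have := hi.2.2 c hc (fun k k1 k2 => by
      have := a3 k (by omega) (by omega)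
      omega)
    rw [hch] at this
    exact absurd (hlt _ (hst _ this le_rfl)) (lt_irrefl _)
  refine ⟨C ∪ (Finset.range (wt h w)).image (fun t => (q + t * (23 - h), h)), ?_, ?_, ?_, ?_⟩
  · intro c hc hcq
    rcases Finset.mem_union.mp hc with hc | hc
    · exact hc
    · have := (hnew c hc).1; omega
  · intro c hc hcq
    rcases Finset.mem_union.mp hc with hc | hc
    · have := hi.2.1 c hc; omega
    · exact (hnew c hc).2.2.2.2
  · rw [Finset.card_union_of_disjoint, Finset.card_image_of_injective, Finset.card_range]
    · intro t t' he
      simp only [Prod.mk.injEq, and_true, add_right_inj] at he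
      exact Nat.eq_of_mul_eq_mul_right (by omega) he
    · rw [Finset.disjoint_left]
      intro c hc hc'
      have := hi.2.1 c hc
      have := (hnew c hc').1
      omega
  · refine ⟨⟨?_, ?_⟩, ?_, ?_⟩
    · intro c hc
      rcases Finset.mem_union.mp hc with hc | hc
      · exact hi.1.1 c hc
      · obtain ⟨n1, n2, n3, n4, -⟩ := hnew c hc
        omega
    · intro c hc c' hc' t hA h1 h2
      rcases Finset.mem_union.mp hc with hc | hc <;> rcases Finset.mem_union.mp hc' with hc' | hc'
      · exact hi.1.2 c hc c' hc' t hA h1 h2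
      · exact (hcross c hc c' hc' t hA h1 h2).elim
      · exact (hcross c' hc' c hc t hA h2 h1).elim
      · obtain ⟨n1, n2, n3, n4, s1, n5⟩ := hnew c hc
        obtain ⟨m1, m2, m3, m4, s2, m5⟩ := hnew c' hc'
        obtain ⟨a1, a2, a3⟩ := hA
        obtain ⟨b1, b2, b3, b4⟩ := h1
        obtain ⟨d1, d2, d3, d4⟩ := h2
        have e1 := a3 _ b1 b2
        apply Prod.ext
        · rcases lt_trichotomy s1 s2 with hlt' | rfl | hlt'
          · have : (s1 + 1) * (23 - h) ≤ s2 * (23 - h) := Nat.mul_le_mul_right _ hlt'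
            rw [add_mul] at this
            omega
          · omega
          · have : (s2 + 1) * (23 - h) ≤ s1 * (23 - h) := Nat.mul_le_mul_right _ hlt'
            rw [add_mul] at this
            omega
        · omega
    · intro c hc
      rcases Finset.mem_union.mp hc with hc | hc
      · have := hi.2.1 c hc; omega
      · exact (hnew c hc).2.1
    · intro c hc hv
      rcases Finset.mem_union.mp hc with hc | hc
      · right
        exact (hi.skip h w hw hseg hst).2.2 c hc hv
      · left; exact (hnew c hc).2.2.1

theorem brec_ble (x y : ℕ) (f t : Bool) :
    @Bool.rec (fun _ => Bool) f t (Nat.ble x y) = if x ≤ y then t else f := by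
  by_cases h : x ≤ y
  · rw [if_pos h, Nat.ble_eq_true_of_le h]
  · have : Nat.ble x y = false := by
      rw [← Bool.not_eq_true]; intro h'; exact h (Nat.le_of_ble_eq_true h')
    rw [if_neg h, this]

theorem brec_beq (x y : ℕ) (f t : Bool) :
    @Bool.rec (fun _ => Bool) f t (Nat.beq x y) = if x = y then t else f := by
  by_cases h : x = y
  · subst h; rw [if_pos rfl, Nat.beq_refl]
  · have : Nat.beq x y = false := by
      rw [← Bool.not_eq_true]; intro h'; exact h (Nat.eq_of_beq_eq_true h')
    rw [if_neg h, this]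

theorem brec_and (b t : Bool) :
    @Bool.rec (fun _ => Bool) false t b = true ↔ b = true ∧ t = true := by
  cases b <;> simp

noncomputable def inn (F : Sk → ℕ → Bool) (h w b : ℕ) (st : Sk) : Bool :=
  @Sk.rec (fun _ => Bool) false
        (fun h' w' t ih2 =>
          @Bool.rec (fun _ => Bool)
            ih2
            (@Bool.rec (fun _ => Bool)
              (@Bool.rec (fun _ => Bool) true
                (F (Sk.cons h w (Sk.cons h' w' t)) (Nat.sub b (wt h w)))
                (Nat.ble (wt h w) b))
              (F (Sk.cons h' w' t) b)
              (Nat.beq h' h))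
            (Nat.ble h h')) st

theorem inn_cons (F : Sk → ℕ → Bool) (h w b h' w' : ℕ) (t : Sk) :
    inn F h w b (cons h' w' t) = if h ≤ h' then
      (if h' = h then F (cons h' w' t) b else
        if wt h w ≤ b then F (cons h w (cons h' w' t)) (b - wt h w) else true)
      else inn F h w b t := by
  rw [← brec_ble (wt h w), ← brec_beq, ← brec_ble h]; rfl

theorem cnt_cons (K : ℕ → Bool) (h w : ℕ) (t st : Sk) (b : ℕ) :
    cnt K (cons h w t) st b = inn (cnt K t) h w b st := rfl

theorem inn_sound (F : Sk → ℕ → Bool) (h w b : ℕ) (st : Sk) : inn F h w b st = true → Srt st →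
    ∃ st', Srt st' ∧ (∀ j, smem j st → h ≤ j → smem j st') ∧
      (F st' b = true ∨ (h < 23 ∧ (∀ j, smem j st' → h < j) ∧
        (wt h w ≤ b → F (cons h w st') (b - wt h w) = true))) := by
  induction st with
  | nil => intro h1; exact absurd h1 (by simp [inn])
  | cons h' w' t ih =>
    intro h1 hs
    rw [inn_cons] at h1
    by_cases hle : h ≤ h'
    · rw [if_pos hle] at h1
      refine ⟨cons h' w' t, hs, fun j hj _ => hj, ?_⟩
      by_cases he : h' = h
      · rw [if_pos he] at h1
        left; exact h1
      · rw [if_neg he] at h1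
        have hs1 := hs.1
        right
        refine ⟨by omega, ?_, fun hb => by rwa [if_pos hb] at h1⟩
        intro j hj
        rcases hj with rfl | hj
        · omega
        · have := hs.2.1 j hj; omega
    · rw [if_neg hle] at h1
      obtain ⟨st', a, b', c⟩ := ih h1 hs.2.2
      refine ⟨st', a, ?_, c⟩
      intro j hj hhj
      rcases hj with rfl | hj
      · omega
      · exact b' j hj hhj

theorem cnt_sound (K : ℕ → Bool) (H : ℕ → ℕ) (B : ℕ) (rs : Sk) : ∀ (q : ℕ) (C : Finset (ℕ × ℕ))
    (st : Sk) (b : ℕ), cnt K rs st b = true → Inv H q C st → Srt st →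
    (∀ i, H (q + i) = ht rs i) → ROK rs → B ≤ C.card + b →
    ∃ C', Indep H C' ∧ (∀ c ∈ C', c.1 < q → c ∈ C) ∧
      (B < C'.card ∨ ∃ sl, K sl = true ∧ B ≤ C'.card + sl) := by
  induction rs with
  | nil =>
    intro q C st b h1 hi _ _ _ hB
    exact ⟨C, hi.1, fun c hc _ => hc, Or.inr ⟨b, h1, hB⟩⟩
  | cons h w t ih =>
    intro q C st b h1 hi hs hH hR hB
    rw [cnt_cons] at h1
    obtain ⟨st', hs', hst, hcase⟩ := inn_sound _ _ _ _ _ h1 hs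
    have hseg : ∀ k, q ≤ k → k < q + w → H k = h := by
      intro k k1 k2
      obtain ⟨i, rfl⟩ := Nat.exists_eq_add_of_le k1
      rw [hH]; simp only [ht]; rw [if_pos (by omega)]
    have hH' : ∀ i, H (q + w + i) = ht t i := by
      intro i
      rw [add_assoc, hH]; simp [ht]
    rcases hcase with hF | ⟨hh, hlt, hF⟩
    · obtain ⟨C', c1, c2, c3⟩ := ih (q + w) C st' b hF (hi.skip h w hR.1 hseg hst) hs' hH' hR.2.2 hB
      exact ⟨C', c1, fun c hc hq => c2 c hc (by omega), c3⟩
    · obtain ⟨C1, p1, p2, p3, p4⟩ := hi.push h w hR.1 hh hseg hst hlt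
      by_cases hb : wt h w ≤ b
      · obtain ⟨C', c1, c2, c3⟩ := ih (q + w) C1 _ _ (hF hb) p4 ⟨hh.le, hlt, hs'⟩ hH' hR.2.2
          (by omega)
        exact ⟨C', c1, fun c hc hq => p1 c (c2 c hc (by omega)) hq, c3⟩
      · exact ⟨C1, p4.1, p1, Or.inl (by omega)⟩

theorem left_inv (ls : Sk) : ∀ (h w : ℕ) (rs : Sk), SOK h ls → (ls = nil ∨ 1 ≤ w) →
    ∃ C, Inv (ht (ra ls (cons h w rs))) (wd ls + w) C (cons h w ls) ∧
      C.card = lw (cons h w ls) ∧ ∀ c ∈ C, wd ls ≤ c.1 → ∃ t, c.1 = wd ls + t * (23 - h) := by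
  induction ls with
  | nil =>
    intro h w rs hs _
    refine ⟨∅, ⟨⟨?_, ?_⟩, ?_, ?_⟩, ?_, ?_⟩
    all_goals try simp
    have : h = 23 := hs
    subst this
    have : lw (cons 23 w nil) = (w + (22 - 23)) / (23 - 23) + 0 := rfl
    rw [this]; simp
  | cons h' w' t ih =>
    intro h w rs hs hw
    have hw : 1 ≤ w := by
      rcases hw with hw | hw
      · cases hw
      · exact hw
    obtain ⟨C, c1, c2, c3⟩ := ih h' w' (cons h w rs) hs.2.2 hs.2.1
    have hle := SOK.le _ _ hs.2.2
    have hlt := hs.1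
    obtain ⟨C1, p1, p2, p3, p4⟩ := c1.push h w hw (by omega) (by
      intro k k1 k2
      obtain ⟨i, rfl⟩ := Nat.exists_eq_add_of_le k1
      have := ht_ra_ge (cons h' w' t) (cons h w rs) i
      simp only [ra, wd] at this
      rw [this]; simp only [ht]; rw [if_pos (by omega)]) (fun j hj _ => hj) (SOK.gt _ _ hs)
    refine ⟨C1, p4, ?_, p2⟩
    rw [p3, c2]
    change _ = wt h w + lw (cons h' w' t)
    omega

/-! ## Soundness of the search -/

def Imp (r : ℕ) (q : Sk) : Prop := ∀ T, Good (ht q) T → T.card ≤ r → False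

theorem Imp.congr {r : ℕ} (ls : Sk) {q q' : Sk} (h : ∀ i, ht q i = ht q' i)
    (hi : Imp r (ra ls q)) : Imp r (ra ls q') := by
  intro T hT hc
  exact hi T (hT.congr (fun i => (ht_ra_congr ls q q' h i).symm)) hc

def VS (V : Sk → ℕ → ℕ → Sk → Bool) (r : ℕ) : Prop :=
  ∀ ls h w rs, V ls h w rs = true → SOK h ls → 1 ≤ w → h < 23 → ROK rs → gtop h rs →
    Imp r (ra ls (cons h w rs))

theorem merge_ht (h w w' : ℕ) (t : Sk) (i : ℕ) :
    ht (cons h (w + w') t) i = ht (cons h w (cons h w' t)) i := by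
  simp only [ht]
  split_ifs <;> first | rfl | omega | (congr 1; omega)

theorem scan_nil (V : Sk → ℕ → ℕ → Sk → Bool) (ls : Sk) (h w : ℕ) :
    scan V nil ls h w = if h = 23 then false else V ls h w nil := by
  rw [← brec_beq]; rfl

theorem scan_cons (V : Sk → ℕ → ℕ → Sk → Bool) (ls : Sk) (h w h' w' : ℕ) (t : Sk) :
    scan V (cons h' w' t) ls h w = if h ≤ h' then
      (if h' = h then scan V t ls h (w + w') else V ls h w (cons h' w' t))
      else scan V t (cons h w ls) h' w' := by
  rw [← force_eq (w + w') (fun w2 => scan V t ls h w2), ← brec_beq, ← brec_ble]; rfl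

theorem scan_sound {V : Sk → ℕ → ℕ → Sk → Bool} {r : ℕ} (hV : VS V r) (rs : Sk) :
    ∀ ls h w, scan V rs ls h w = true → SOK h ls → 1 ≤ w → h ≤ 23 → ROK rs →
      Imp r (ra ls (cons h w rs)) := by
  induction rs with
  | nil =>
    intro ls h w h1 hs hw hh hR
    rw [scan_nil] at h1
    split_ifs at h1 with he
    exact hV _ _ _ _ h1 hs hw (by omega) hR trivial
  | cons h' w' t ih =>
    intro ls h w h1 hs hw hh hR
    rw [scan_cons] at h1
    split_ifs at h1 with h2 h3
    · subst h3
      exact Imp.congr ls (merge_ht h' w w' t) (ih _ _ _ h1 hs (by omega) hh hR.2.2)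
    · have := hR.2.1
      exact hV _ _ _ _ h1 hs hw (by omega) hR (show h < h' by omega)
    · exact ih (cons h w ls) h' w' h1 ⟨by omega, Or.inr hw, hs⟩ hR.1 hR.2.1 hR.2.2

theorem fill_cons (V : Sk → ℕ → ℕ → Sk → Bool) (h w h' w' : ℕ) (t rs : Sk) :
    fill V (cons h' w' t) h w rs = if h ≤ h' then
      (if h' = h then scan V rs t h (w + w') else scan V rs (cons h' w' t) h w)
      else V t h' w' (cons h w rs) := by
  rw [← force_eq (w + w') (fun w2 => scan V rs t h w2), ← brec_beq, ← brec_ble]; rfl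

theorem fill_sound {V : Sk → ℕ → ℕ → Sk → Bool} {r : ℕ} (hV : VS V r) (ls rs : Sk)
    (h0 h w : ℕ) (h1 : fill V ls h w rs = true) (hs : SOK h0 ls) (hw : 1 ≤ w) (hh : h ≤ 23)
    (hR : ROK rs) : Imp r (ra ls (cons h w rs)) := by
  cases ls with
  | nil => exact absurd h1 (by simp [fill])
  | cons h' w' t =>
    rw [fill_cons] at h1
    split_ifs at h1 with h2 h3
    · subst h3
      have := scan_sound hV rs t h' (w + w') h1 hs.2.2 (by omega) hh hR
      rw [add_comm] at this
      exact Imp.congr t (merge_ht h' w' w rs) this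
    · exact scan_sound hV rs (cons h' w' t) h w h1 ⟨by omega, hs.2.1, hs.2.2⟩ hw hh hR
    · refine hV t h' w' (cons h w rs) h1 hs.2.2 ?_ (by omega) ⟨hw, hh, hR⟩ (show h' < h by omega)
      rcases hs.2.1 with rfl | h4
      · have : h' = 23 := hs.2.2
        omega
      · exact h4

theorem split_sound {V : Sk → ℕ → ℕ → Sk → Bool} {ls rs : Sk} {h w : ℕ}
    (h1 : split V ls h w rs = true) (z : ℕ) (hz : 1 ≤ z) (hzw : z < w) (hzh : h + z ≤ 23) :
    V ls h (w - z) (cons (h + z) z rs) = true := by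
  have key : ∀ n, @Nat.rec (fun _ => Bool) true
    (fun k ih => @Bool.rec (fun _ => Bool) false ih
       (@Bool.rec (fun _ => Bool) true
         (force (Nat.sub w (Nat.succ k)) (fun w' => force (Nat.add h (Nat.succ k)) (fun h' =>
           V ls h w' (Sk.cons h' (Nat.succ k) rs))))
         (Nat.ble (Nat.add h (Nat.succ k)) 23))) n = true → z ≤ n →
      V ls h (w - z) (cons (h + z) z rs) = true := by
    intro n
    induction n with
    | zero => intro _ h3; omega
    | succ k ih =>
      intro h2 h3
      obtain ⟨h4, h5⟩ := (brec_and _ _).mp h2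
      by_cases hk : z ≤ k
      · exact ih h5 hk
      · have : z = k + 1 := by omega
        subst this
        rw [brec_ble, force_eq, force_eq] at h4
        have h6 : Nat.add h (Nat.succ k) ≤ 23 := hzh
        rw [if_pos h6] at h4
        exact h4
  exact key (w - 1) h1 (by omega)

theorem valley_succ (r : ℕ) (ls : Sk) (h w : ℕ) (rs : Sk) : valley (r + 1) ls h w rs =
    if lw (cons h w ls) ≤ r + 1 then
      cnt (node (valley r) ls h w rs) rs (cons h w ls) (r + 1 - lw (cons h w ls)) else true := by
  rw [← brec_ble]; rfl

theorem valley_sound (r : ℕ) : VS (valley r) r := by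
  induction r with
  | zero =>
    intro ls h w rs _ hs hw hh hR hg T hT hc
    obtain ⟨z, -, -, -, h4, -⟩ := list_step hT hs hw hh hR hg
    have := Finset.card_pos.mpr ⟨_, h4⟩
    omega
  | succ r ih =>
    intro ls h w rs h1 hs hw hh hR hg T hT hc
    rw [valley_succ] at h1
    have hcov : ∀ C, Indep (ht (ra ls (cons h w rs))) C → ∀ c ∈ C, ∃ t ∈ T,
        Adm (ht (ra ls (cons h w rs))) t ∧ Cov t c.1 c.2 := by
      intro C hC c hcC
      obtain ⟨e1, e2⟩ := hC.1 c hcC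
      obtain ⟨t, t1, t2⟩ := hT.2.1 c.1 c.2 e1.le e2
      exact ⟨t, t1, hT.1 t t1, t2⟩
    obtain ⟨C, c1, c2, c3⟩ := left_inv ls h w rs hs (Or.inr hw)
    have hle := c1.1.card_le T (hcov C c1.1)
    rw [if_pos (by omega)] at h1
    obtain ⟨C', d1, d2, d3⟩ := cnt_sound _ (ht (ra ls (cons h w rs))) (r + 1) rs (wd ls + w) C _ _
      h1 c1 (SOK.srt _ _ _ hs) (by
        intro i
        rw [add_assoc, ht_ra_ge]; simp [ht]) hR (by omega)
    have hle' := d1.card_le T (hcov C' d1)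
    rcases d3 with d3 | ⟨sl, hsl, hB⟩
    · omega
    obtain ⟨z, z1, z2, z3, z4, z5⟩ := list_step hT hs hw hh hR hg
    have hcard : (T.erase (wd ls + w - z, h, z)).card = T.card - 1 := Finset.card_erase_of_mem z4
    have hn : (if h + w ≤ 23 then (@Bool.rec (fun _ => Bool) false
      (@Nat.rec (fun _ => Bool) true (fun _ _ => split (valley r) ls h w rs) sl)
      (force (Nat.add h w) (fun h' => fill (valley r) ls h' w rs)))
      else split (valley r) ls h w rs) = true := by
      rw [← brec_ble]; exact hsl
    have hsplit : z < w → split (valley r) ls h w rs = true → False := by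
      intro hzw hsp
      exact ih _ _ _ _ (split_sound hsp z z1 hzw z3) hs (by omega) hh ⟨z1, z3, hR⟩
        (show h < h + z by omega) _ z5 (by omega)
    by_cases hhw : h + w ≤ 23
    · rw [if_pos hhw] at hn
      obtain ⟨n1, n2⟩ := (brec_and _ _).mp hn
      rw [force_eq] at n1
      by_cases hzw : z < w
      · cases sl with
        | succ m => exact hsplit hzw n2
        | zero =>
          have := d1.card_le (T.erase (wd ls + w - z, h, z)) (by
            intro c hcC
            obtain ⟨t, t1, t2, t3⟩ := hcov C' d1 c hcC
            refine ⟨t, Finset.mem_erase.mpr ⟨?_, t1⟩, t2, t3⟩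
            rintro rfl
            obtain ⟨b1, b2, b3, b4⟩ := t3
            simp only at b1 b2 b3 b4
            obtain ⟨s', hs'⟩ := c3 c (d2 c hcC (by omega)) (by omega)
            rcases Nat.eq_zero_or_pos s' with rfl | hpos
            · omega
            · have : 1 * (23 - h) ≤ s' * (23 - h) := Nat.mul_le_mul_right _ hpos
              omega)
          have := Finset.card_pos.mpr ⟨_, z4⟩
          omega
      · have hz : z = w := by omega
        subst hz
        refine fill_sound ih ls rs h (h + z) z n1 hs hw hhw hR _ (z5.congr ?_) (by omega)
        intro i
        apply ht_ra_congr
        intro i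
        simp [ht]
    · rw [if_neg hhw] at hn
      exact hsplit (by omega) hn

theorem row_succ (a k w : ℕ) (rs : Sk) (h : row a (k + 1) w rs = true) :
    (w ≤ a → fill (valley (k + 8)) (cons 23 0 nil) w w rs = true) ∧
    ∀ z, 1 ≤ z → z < w → row a k (w - z) (cons z z rs) = true := by
  obtain ⟨h1, h2⟩ := (brec_and _ _).mp h
  rw [brec_ble] at h1
  refine ⟨fun hw => by rwa [if_pos hw] at h1, ?_⟩
  intro z hz hzw
  have key : ∀ n, @Nat.rec (fun _ => Bool) true
          (fun z ih => @Bool.rec (fun _ => Bool) false ih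
            (row a k (Nat.sub w (Nat.succ z)) (Sk.cons (Nat.succ z) (Nat.succ z) rs))) n = true →
      z ≤ n → row a k (w - z) (cons z z rs) = true := by
    intro n
    induction n with
    | zero => intro _ h3; omega
    | succ m ih =>
      intro h2 h3
      obtain ⟨h4, h5⟩ := (brec_and _ _).mp h2
      by_cases hk : z ≤ m
      · exact ih h5 hk
      · have : z = m + 1 := by omega
        subst this
        exact h4
  exact key (w - 1) h2 (by omega)

theorem row_sound (a k : ℕ) : ∀ (w : ℕ) (rs : Sk) (T : Finset (ℕ × ℕ × ℕ)),
    row a k w rs = true → 1 ≤ w → ROK rs → gtop 0 rs →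
    Good (ht (ra (cons 23 0 nil) (cons 0 w rs))) T → T.card ≤ k + 8 →
    (T.filter (fun t => t.2.1 = 0)).card ≤ k →
    (∀ t ∈ T, t.1 = 0 → t.2.1 = 0 → t.2.2 ≤ a) → False := by
  induction k with
  | zero =>
    intro w rs T _ hw hR hg hT _ hb _
    obtain ⟨z, -, -, -, h4, -⟩ := list_step hT (by simp [SOK]) hw (by omega) hR hg
    have hm : (wd (cons 23 0 nil) + w - z, 0, z) ∈ T.filter (fun t => t.2.1 = 0) :=
      Finset.mem_filter.mpr ⟨h4, rfl⟩
    have := Finset.card_pos.mpr ⟨_, hm⟩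
    omega
  | succ k ih =>
    intro w rs T h1 hw hR hg hT hc hb ha
    obtain ⟨r1, r2⟩ := row_succ _ _ _ _ h1
    obtain ⟨z, z1, z2, z3, z4, z5⟩ := list_step hT (by simp [SOK]) hw (by omega) hR hg
    have hcard := Finset.card_erase_of_mem z4
    by_cases hzw : z < w
    · refine ih (w - z) (cons z z rs) _ (r2 z z1 hzw) (by omega) ⟨z1, by omega, hR⟩
        (show 0 < z by omega) (by simpa using z5) (by omega) ?_
        (fun t ht => ha t (Finset.mem_of_mem_erase ht))
      have hm : (wd (cons 23 0 nil) + w - z, 0, z) ∈ T.filter (fun t => t.2.1 = 0) :=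
        Finset.mem_filter.mpr ⟨z4, rfl⟩
      rw [Finset.filter_erase, Finset.card_erase_of_mem hm]
      omega
    · have hz : z = w := by omega
      subst hz
      have := r1 (ha _ z4 (by simp [wd]) rfl)
      refine fill_sound (valley_sound (k + 8)) _ rs 0 z z this (by simp [SOK]) hw (by omega) hR _
        (z5.congr ?_) (by omega)
      intro i
      apply ht_ra_congr
      intro i
      simp [ht]


/-! ## Tilings and their symmetries -/

def GT (T : Finset (ℕ × ℕ × ℕ)) : Prop :=
  (∀ t ∈ T, 1 ≤ t.2.2 ∧ t.2.2 ≤ 22 ∧ t.1 + t.2.2 ≤ 23 ∧ t.2.1 + t.2.2 ≤ 23) ∧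
  (∀ i j, i < 23 → j < 23 → ∃ t ∈ T, Cov t i j) ∧
  (∀ t ∈ T, ∀ t' ∈ T, ∀ i j, Cov t i j → Cov t' i j → t = t')

theorem core (T : Finset (ℕ × ℕ × ℕ)) (hT : GT T) (hc : T.card ≤ 12)
    (hb : (T.filter (fun t => t.2.1 = 0)).card ≤ 4)
    (hcor : ∀ t ∈ T, ∀ t' ∈ T, t.1 = 0 → t.2.1 = 0 → t'.2.1 = 0 → t'.1 + t'.2.2 = 23 →
      t.2.2 ≤ t'.2.2) : False := by
  obtain ⟨g1, g2, g3⟩ := hT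
  have hgood : Good (ht (ra (cons 23 0 nil) (cons 0 23 nil))) T := by
    have e : ∀ i, ht (ra (cons 23 0 nil) (cons 0 23 nil)) i = if i < 23 then 0 else 23 := by
      intro i
      simp [ra, ht]
    refine ⟨?_, ?_, g3⟩
    · intro t ht
      obtain ⟨a1, a2, a3, a4⟩ := g1 t ht
      refine ⟨a1, a4, ?_⟩
      intro k k1 k2
      rw [e, if_pos (by omega)]
      omega
    · intro i j hi hj
      rw [e] at hi
      split_ifs at hi with h
      · exact g2 i j h hj
      · omega
  obtain ⟨z, z1, z2, z3, z4, z5⟩ :=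
    list_step hgood (by simp [SOK]) (by omega) (by omega) (by simp [ROK]) (by simp [gtop])
  have hz := (g1 _ z4).2.1
  simp only at hz
  have hcard := Finset.card_erase_of_mem z4
  have hm : (wd (cons 23 0 nil) + 23 - z, 0, z) ∈ T.filter (fun t => t.2.1 = 0) :=
    Finset.mem_filter.mpr ⟨z4, rfl⟩
  refine row_sound z 3 (23 - z) (cons z z nil) _ (start_all z z1 hz) (by omega)
    ⟨z1, by omega, trivial⟩ (show 0 < z by omega) (by simpa using z5) (by omega) ?_ ?_
  · rw [Finset.filter_erase, Finset.card_erase_of_mem hm]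
    omega
  · intro t ht h1 h2
    refine hcor t (Finset.mem_of_mem_erase ht) _ z4 h1 h2 rfl ?_
    simp only [wd]
    omega

def rho (t : ℕ × ℕ × ℕ) : ℕ × ℕ × ℕ := (23 - t.1 - t.2.2, t.2.1, t.2.2)
def sig (t : ℕ × ℕ × ℕ) : ℕ × ℕ × ℕ := (t.2.1, t.1, t.2.2)

theorem GT.rho {T : Finset (ℕ × ℕ × ℕ)} (hT : GT T) : GT (T.image rho) := by
  obtain ⟨g1, g2, g3⟩ := hT
  refine ⟨?_, ?_, ?_⟩
  · intro t ht
    obtain ⟨u, hu, rfl⟩ := Finset.mem_image.mp ht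
    obtain ⟨a1, a2, a3, a4⟩ := g1 u hu
    simp only [Sk.rho]
    omega
  · intro i j hi hj
    obtain ⟨u, hu, c⟩ := g2 (22 - i) j (by omega) hj
    refine ⟨Sk.rho u, Finset.mem_image_of_mem _ hu, ?_⟩
    obtain ⟨a1, a2, a3, a4⟩ := g1 u hu
    simp only [Cov, Sk.rho] at *
    omega
  · intro t ht t' ht' i j c c'
    obtain ⟨u, hu, rfl⟩ := Finset.mem_image.mp ht
    obtain ⟨u', hu', rfl⟩ := Finset.mem_image.mp ht'
    obtain ⟨a1, a2, a3, a4⟩ := g1 u hu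
    obtain ⟨b1, b2, b3, b4⟩ := g1 u' hu'
    congr 1
    refine g3 u hu u' hu' (22 - i) j ?_ ?_
    · simp only [Cov, Sk.rho] at *
      omega
    · simp only [Cov, Sk.rho] at *
      omega

theorem GT.sig {T : Finset (ℕ × ℕ × ℕ)} (hT : GT T) : GT (T.image sig) := by
  obtain ⟨g1, g2, g3⟩ := hT
  refine ⟨?_, ?_, ?_⟩
  · intro t ht
    obtain ⟨u, hu, rfl⟩ := Finset.mem_image.mp ht
    obtain ⟨a1, a2, a3, a4⟩ := g1 u hu
    simp only [Sk.sig]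
    omega
  · intro i j hi hj
    obtain ⟨u, hu, c⟩ := g2 j i hj hi
    refine ⟨Sk.sig u, Finset.mem_image_of_mem _ hu, ?_⟩
    simp only [Cov, Sk.sig] at *
    omega
  · intro t ht t' ht' i j c c'
    obtain ⟨u, hu, rfl⟩ := Finset.mem_image.mp ht
    obtain ⟨u', hu', rfl⟩ := Finset.mem_image.mp ht'
    congr 1
    refine g3 u hu u' hu' j i ?_ ?_
    · simp only [Cov, Sk.sig] at *
      omega
    · simp only [Cov, Sk.sig] at *
      omega

theorem filter_image_le (T : Finset (ℕ × ℕ × ℕ)) (f : ℕ × ℕ × ℕ → ℕ × ℕ × ℕ)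
    (p q : ℕ × ℕ × ℕ → Prop) [DecidablePred p] [DecidablePred q]
    (h : ∀ t ∈ T, p (f t) → q t) :
    ((T.image f).filter p).card ≤ (T.filter q).card := by
  refine le_trans (Finset.card_le_card ?_) (Finset.card_image_le (f := f))
  intro t ht
  obtain ⟨h1, h2⟩ := Finset.mem_filter.mp ht
  obtain ⟨u, hu, rfl⟩ := Finset.mem_image.mp h1
  exact Finset.mem_image_of_mem _ (Finset.mem_filter.mpr ⟨hu, h u hu h2⟩)

/-- bottom side with at most four squares -/
theorem core2 (T : Finset (ℕ × ℕ × ℕ)) (hT : GT T) (hc : T.card ≤ 12)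
    (hb : (T.filter (fun t => t.2.1 = 0)).card ≤ 4) : False := by
  obtain ⟨l, hl, cl⟩ := hT.2.1 0 0 (by omega) (by omega)
  obtain ⟨r, hr, cr⟩ := hT.2.1 22 0 (by omega) (by omega)
  have ul : ∀ t ∈ T, t.1 = 0 → t.2.1 = 0 → t = l := by
    intro t ht h1 h2
    have := hT.1 t ht
    exact hT.2.2 t ht l hl 0 0 (by simp only [Cov]; omega) cl
  have ur : ∀ t ∈ T, t.2.1 = 0 → t.1 + t.2.2 = 23 → t = r := by
    intro t ht h1 h2
    have := hT.1 t ht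
    exact hT.2.2 t ht r hr 22 0 (by simp only [Cov]; omega) cr
  rcases le_total l.2.2 r.2.2 with h | h
  · refine core T hT hc hb ?_
    intro t ht t' ht' h1 h2 h3 h4
    rw [ul t ht h1 h2, ur t' ht' h3 h4]
    exact h
  · refine core (T.image rho) hT.rho (le_trans Finset.card_image_le hc)
      (le_trans (filter_image_le _ _ _ _ (fun t _ h => h)) hb) ?_
    intro t ht t' ht' h1 h2 h3 h4
    obtain ⟨u, hu, rfl⟩ := Finset.mem_image.mp ht
    obtain ⟨u', hu', rfl⟩ := Finset.mem_image.mp ht'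
    obtain ⟨a1, a2, a3, a4⟩ := hT.1 u hu
    obtain ⟨b1, b2, b3, b4⟩ := hT.1 u' hu'
    simp only [rho] at *
    rw [ur u hu h2 (by omega), ul u' hu' (by omega) h3]
    exact h

theorem left_imp (T : Finset (ℕ × ℕ × ℕ)) (hT : GT T) (hc : T.card ≤ 12)
    (hb : (T.filter (fun t => t.1 = 0)).card ≤ 4) : False :=
  core2 (T.image sig) hT.sig (le_trans Finset.card_image_le hc)
    (le_trans (filter_image_le _ _ _ _ (fun _ _ h => h)) hb)

theorem right_imp (T : Finset (ℕ × ℕ × ℕ)) (hT : GT T) (hc : T.card ≤ 12)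
    (hb : (T.filter (fun t => t.1 + t.2.2 = 23)).card ≤ 4) : False :=
  left_imp (T.image rho) hT.rho (le_trans Finset.card_image_le hc)
    (le_trans (filter_image_le _ _ _ _ (fun t ht h => by
      have := hT.1 t ht
      simp only [rho] at h
      omega)) hb)

theorem top_imp (T : Finset (ℕ × ℕ × ℕ)) (hT : GT T) (hc : T.card ≤ 12)
    (hb : (T.filter (fun t => t.2.1 + t.2.2 = 23)).card ≤ 4) : False :=
  right_imp (T.image sig) hT.sig (le_trans Finset.card_image_le hc)
    (le_trans (filter_image_le _ _ _ _ (fun _ _ h => h)) hb)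

open Classical in
theorem corner_le (T : Finset (ℕ × ℕ × ℕ)) (hT : GT T) (i j : ℕ) :
    (T.filter (fun t => Cov t i j)).card ≤ 1 := by
  rw [Finset.card_le_one]
  intro a ha b hb
  obtain ⟨a1, a2⟩ := Finset.mem_filter.mp ha
  obtain ⟨b1, b2⟩ := Finset.mem_filter.mp hb
  exact hT.2.2 a a1 b b1 i j a2 b2

open Classical in
theorem sides (T : Finset (ℕ × ℕ × ℕ)) (hT : GT T) :
    (T.filter (fun t => t.2.1 = 0)).card + (T.filter (fun t => t.1 = 0)).card +
    (T.filter (fun t => t.1 + t.2.2 = 23)).card + (T.filter (fun t => t.2.1 + t.2.2 = 23)).card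
    ≤ T.card + 4 := by
  have h1 := corner_le T hT 0 0
  have h2 := corner_le T hT 22 0
  have h3 := corner_le T hT 0 22
  have h4 := corner_le T hT 22 22
  suffices h : (T.filter (fun t => t.2.1 = 0)).card + (T.filter (fun t => t.1 = 0)).card +
      (T.filter (fun t => t.1 + t.2.2 = 23)).card + (T.filter (fun t => t.2.1 + t.2.2 = 23)).card
      ≤ T.card + (T.filter (fun t => Cov t 0 0)).card + (T.filter (fun t => Cov t 22 0)).card +
      (T.filter (fun t => Cov t 0 22)).card + (T.filter (fun t => Cov t 22 22)).card by omega
  simp only [Finset.card_filter]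
  rw [Finset.card_eq_sum_ones]
  simp only [← Finset.sum_add_distrib]
  refine Finset.sum_le_sum ?_
  intro t ht
  obtain ⟨a1, a2, a3, a4⟩ := hT.1 t ht
  have key : ∀ (p q : Prop) [Decidable p] [Decidable q], (p → q) →
      (if p then 1 else 0) ≤ (if q then 1 else 0 : ℕ) := by
    intro p q _ _ h
    by_cases hp : p
    · simp [hp, h hp]
    · simp [hp]
  have k1 := key (t.2.1 = 0 ∧ t.1 = 0) (Cov t 0 0) (by simp only [Cov]; omega)
  have k2 := key (t.2.1 = 0 ∧ t.1 + t.2.2 = 23) (Cov t 22 0) (by simp only [Cov]; omega)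
  have k3 := key (t.2.1 + t.2.2 = 23 ∧ t.1 = 0) (Cov t 0 22) (by simp only [Cov]; omega)
  have k4 := key (t.2.1 + t.2.2 = 23 ∧ t.1 + t.2.2 = 23) (Cov t 22 22)
    (by simp only [Cov]; omega)
  refine le_trans ?_ (add_le_add (add_le_add (add_le_add (add_le_add le_rfl k1) k2) k3) k4)
  by_cases b1 : t.2.1 = 0 <;> by_cases b2 : t.1 = 0 <;> by_cases b3 : t.1 + t.2.2 = 23 <;>
    by_cases b4 : t.2.1 + t.2.2 = 23 <;> simp only [b1, b2, b3, b4, true_and, and_true,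
      false_and, and_false, if_true, if_false, and_self] <;> (try split_ifs) <;> omega

theorem lower (T : Finset (ℕ × ℕ × ℕ)) (hT : GT T) : 13 ≤ T.card := by
  by_contra hlt
  have hc : T.card ≤ 12 := by omega
  have := sides T hT
  by_cases h1 : (T.filter (fun t => t.2.1 = 0)).card ≤ 4
  · exact core2 T hT hc h1
  by_cases h2 : (T.filter (fun t => t.1 = 0)).card ≤ 4
  · exact left_imp T hT hc h2
  by_cases h3 : (T.filter (fun t => t.1 + t.2.2 = 23)).card ≤ 4
  · exact right_imp T hT hc h3
  by_cases h4 : (T.filter (fun t => t.2.1 + t.2.2 = 23)).card ≤ 4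
  · exact top_imp T hT hc h4
  omega

theorem GT.of {T : Finset (ℕ × ℕ × ℕ)} (h : IsSquaredTiling 23 T) : GT T := by
  obtain ⟨h1, h2⟩ := h
  refine ⟨fun t ht => h1 t ht, ?_, ?_⟩
  · intro i j hi hj
    obtain ⟨t, ht, -⟩ := h2 i j hi hj
    exact ⟨t, ht.1, ht.2⟩
  · intro t ht t' ht' i j c c'
    obtain ⟨a1, a2, a3, a4⟩ := h1 t ht
    exact (h2 i j (by have := c.2.1; omega) (by have := c.2.2.2; omega)).unique ⟨ht, c⟩ ⟨ht', c'⟩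

def ex : Finset (ℕ × ℕ × ℕ) :=
  {(0,0,13), (13,0,10), (13,10,4), (17,10,6), (0,13,10), (10,13,2), (12,13,1), (12,14,3),
    (15,14,2), (10,15,2), (15,16,1), (16,16,7), (10,17,6)}

theorem ex_tiling : IsSquaredTiling 23 ex := by
  have c1 : ∀ i < 23, ∀ j < 23, ∃ t ∈ ex,
      t.1 ≤ i ∧ i < t.1 + t.2.2 ∧ t.2.1 ≤ j ∧ j < t.2.1 + t.2.2 := by decide +kernel
  have c2 : ∀ t ∈ ex, ∀ t' ∈ ex, t = t' ∨ t.1 + t.2.2 ≤ t'.1 ∨ t'.1 + t'.2.2 ≤ t.1 ∨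
      t.2.1 + t.2.2 ≤ t'.2.1 ∨ t'.2.1 + t'.2.2 ≤ t.2.1 := by decide +kernel
  refine ⟨by decide +kernel, ?_⟩
  intro i j hi hj
  obtain ⟨t, ht, c⟩ := c1 i hi j hj
  refine ⟨t, ⟨ht, c⟩, ?_⟩
  rintro t' ⟨ht', c'⟩
  rcases c2 t' ht' t ht with h | h | h | h | h
  · exact h
  all_goals omega

end Sk

theorem s_23 : s 23 = 13 := by
  have hm : 13 ∈ {k | ∃ T : Finset (ℕ × ℕ × ℕ), IsSquaredTiling 23 T ∧ T.card = k} :=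
    ⟨Sk.ex, Sk.ex_tiling, by decide +kernel⟩
  apply le_antisymm
  · exact Nat.sInf_le hm
  · obtain ⟨T, hT, hc⟩ := Nat.sInf_mem ⟨_, hm⟩
    have := Sk.lower T (Sk.GT.of hT)
    rw [hc] at this
    exact this
end

section
/- s(29) = 14: the minimum number of squares in a squared tiling of the 29×29 square by strictly smaller integer squares equals 14. -/
def Cov (q : ℕ × ℕ × ℕ) (i j : ℕ) : Prop :=
  q.1 ≤ i ∧ i < q.1 + q.2.2 ∧ q.2.1 ≤ j ∧ j < q.2.1 + q.2.2

structure Fill (F : ℕ → ℕ) (R : Finset (ℕ × ℕ × ℕ)) : Prop where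
  pos : ∀ q ∈ R, 1 ≤ q.2.2
  le28 : ∀ q ∈ R, q.2.2 ≤ 28
  inn : ∀ q ∈ R, ∀ c, q.1 ≤ c → c < q.1 + q.2.2 → q.2.1 + q.2.2 ≤ F c
  cov : ∀ i j, j < F i → ∃ q ∈ R, Cov q i j
  unq : ∀ q ∈ R, ∀ q' ∈ R, ∀ i j, Cov q i j → Cov q' i j → q = q'

def touch (q : ℕ × ℕ × ℕ) : ℕ :=
  (if q.1 = 0 then 1 else 0) + (if q.1 + q.2.2 = 29 then 1 else 0) + (if q.2.1 = 0 then 1 else 0)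

def Fills (F : ℕ → ℕ) (r D : ℕ) : Prop :=
  ∃ R, Fill F R ∧ R.card ≤ r ∧ D ≤ ∑ q ∈ R, touch q

def upd (F : ℕ → ℕ) (p s : ℕ) : ℕ → ℕ := fun c => if p ≤ c ∧ c < p + s then F c - s else F c

lemma Fill.step {F R} (h : Fill F R) {p w d : ℕ} (hw : 1 ≤ w) (hd : 1 ≤ d)
    (hF : ∀ c, p ≤ c → c < p + w → F c = d) (hl : ∀ c, c + 1 = p → F c < d) (hr : F (p + w) < d) :
    ∃ s, 1 ≤ s ∧ s ≤ w ∧ s ≤ d ∧ (p, d - s, s) ∈ R ∧ Fill (upd F p s) (R.erase (p, d - s, s)) := by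
  have hFp := hF p le_rfl (by omega)
  obtain ⟨⟨x, y, s⟩, hq, hc1, hc2, hc3, hc4⟩ := h.cov p (d - 1) (by omega)
  simp only at hc1 hc2 hc3 hc4
  have hin := h.inn _ hq
  have h1 := h.pos _ hq
  simp only at hin h1
  have hy : y + s = d := by have := hin p hc1 hc2; omega
  have hx : x = p := by
    by_contra hne
    have := hin (p - 1) (by omega) (by omega)
    have := hl (p - 1) (by omega)
    omega
  subst hx
  have hsw : s ≤ w := by
    by_contra hne
    have := hin (x + w) (by omega) (by omega)
    omega
  obtain rfl : y = d - s := by omega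
  refine ⟨s, h1, hsw, by omega, hq, ?_, ?_, ?_, ?_, ?_⟩
  · intro q hq'; exact h.pos q (Finset.mem_of_mem_erase hq')
  · intro q hq'; exact h.le28 q (Finset.mem_of_mem_erase hq')
  · intro q hq' c hc hc'
    have hqR := Finset.mem_of_mem_erase hq'
    have hi := h.inn q hqR c hc hc'
    unfold upd
    split_ifs with hcc
    · have hFc := hF c hcc.1 (by omega)
      by_contra hlt
      have hp := h.pos q hqR
      apply Finset.ne_of_mem_erase hq'
      refine h.unq q hqR _ hq c (q.2.1 + q.2.2 - 1) ⟨hc, hc', by omega, by omega⟩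
        ⟨hcc.1, hcc.2, ?_, ?_⟩ <;> simp only <;> omega
    · exact hi
  · intro i j hj
    unfold upd at hj
    have hj' : j < F i := by split_ifs at hj <;> omega
    obtain ⟨q, hqR, hqc⟩ := h.cov i j hj'
    refine ⟨q, Finset.mem_erase.2 ⟨?_, hqR⟩, hqc⟩
    rintro rfl
    obtain ⟨a1, a2, a3, a4⟩ := hqc
    simp only at a1 a2 a3 a4
    rw [if_pos ⟨a1, a2⟩, hF i a1 (by omega)] at hj
    omega
  · intro q hq1 q' hq2
    exact h.unq q (Finset.mem_of_mem_erase hq1) q' (Finset.mem_of_mem_erase hq2)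

lemma Fill.in29 {F R} (h : Fill F R) (h0 : ∀ c, 29 ≤ c → F c = 0) {q} (hq : q ∈ R) :
    q.1 + q.2.2 ≤ 29 := by
  by_contra hne
  have h1 := h.pos q hq
  have := h.inn q hq (q.1 + q.2.2 - 1) (by omega) (by omega)
  rw [h0 _ (by omega)] at this
  omega

lemma Fill.dbound {F R} (h : Fill F R) :
    ∑ q ∈ R, touch q ≤ R.card + 2 := by
  have hA : (R.filter (fun q => q.1 = 0 ∧ q.2.1 = 0)).card ≤ 1 := by
    rw [Finset.card_le_one]
    intro a ha b hb
    simp only [Finset.mem_filter] at ha hb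
    have := h.pos a ha.1
    have := h.pos b hb.1
    exact h.unq a ha.1 b hb.1 0 0 ⟨by omega, by omega, by omega, by omega⟩
      ⟨by omega, by omega, by omega, by omega⟩
  have hB : (R.filter (fun q => q.1 + q.2.2 = 29 ∧ q.2.1 = 0)).card ≤ 1 := by
    rw [Finset.card_le_one]
    intro a ha b hb
    simp only [Finset.mem_filter] at ha hb
    have := h.pos a ha.1
    have := h.pos b hb.1
    exact h.unq a ha.1 b hb.1 28 0 ⟨by omega, by omega, by omega, by omega⟩
      ⟨by omega, by omega, by omega, by omega⟩
  have hle : ∑ q ∈ R, touch q ≤ ∑ q ∈ R, (1 + (if q.1 = 0 ∧ q.2.1 = 0 then 1 else 0)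
      + (if q.1 + q.2.2 = 29 ∧ q.2.1 = 0 then 1 else 0)) := by
    apply Finset.sum_le_sum
    intro q hq
    have h1 := h.le28 q hq
    unfold touch
    split_ifs <;> omega
  rw [Finset.sum_add_distrib, Finset.sum_add_distrib, ← Finset.card_filter,
    ← Finset.card_filter] at hle
  simp only [Finset.sum_const, smul_eq_mul, mul_one] at hle
  omega

def Floor (F : ℕ → ℕ) (q : ℕ × ℕ × ℕ) : Prop :=
  ∃ c, q.1 ≤ c ∧ c < q.1 + q.2.2 ∧ q.2.1 + q.2.2 = F c

def Indep (F : ℕ → ℕ) (C : Finset ℕ) : Prop :=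
  (∀ c ∈ C, 0 < F c) ∧ ∀ c₁ ∈ C, ∀ c₂ ∈ C, c₁ < c₂ → F c₁ = F c₂ →
    c₁ + F c₁ ≤ c₂ ∨ ∃ c, c₁ < c ∧ c < c₂ ∧ F c < F c₁

open Classical in
lemma Fill.lbound {F R} (h : Fill F R) {C : Finset ℕ} (hC : Indep F C) :
    C.card ≤ (R.filter (Floor F)).card := by
  have hex : ∀ c ∈ C, ∃ q ∈ R, Cov q c (F c - 1) := fun c hc =>
    h.cov c (F c - 1) (by have := hC.1 c hc; omega)
  choose! f hf using hex
  have key : ∀ c ∈ C, (f c).2.1 + (f c).2.2 = F c := by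
    intro c hc
    obtain ⟨hR, a1, a2, a3, a4⟩ := hf c hc
    have := h.inn _ hR c a1 a2
    have := hC.1 c hc
    omega
  have main : ∀ c₁ ∈ C, ∀ c₂ ∈ C, c₁ < c₂ → f c₁ ≠ f c₂ := by
    intro c₁ h₁ c₂ h₂ hlt heq
    have k1 := key c₁ h₁
    have k2 := key c₂ h₂
    obtain ⟨hR, a1, a2, a3, a4⟩ := hf c₁ h₁
    obtain ⟨hR', b1, b2, b3, b4⟩ := hf c₂ h₂
    rw [← heq] at k2 b1 b2
    rcases hC.2 c₁ h₁ c₂ h₂ hlt (by omega) with h3 | ⟨c, h3, h4, h5⟩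
    · omega
    · have := h.inn _ hR c (by omega) (by omega)
      omega
  refine Finset.card_le_card_of_injOn f ?_ ?_
  · intro c hc
    have hc' : c ∈ C := hc
    obtain ⟨hR, a1, a2, a3, a4⟩ := hf c hc'
    simp only [Finset.coe_filter, Set.mem_ofPred_eq]
    exact ⟨hR, c, a1, a2, key c hc'⟩
  · intro a ha b hb hab
    rcases lt_trichotomy a b with hl | hl | hl
    · exact absurd hab (main a ha b hb hl)
    · exact hl
    · exact absurd hab.symm (main b hb a ha hl)
set_option maxRecDepth 100000
inductive Sky | nil | cons (w d : ℕ) (t : Sky)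
namespace Sky
noncomputable section
abbrev frc {α : Type} (x : ℕ) (k : ℕ → α) : α := Nat.rec (k (nat_lit 0)) (fun p _ => k (Nat.succ p)) x
abbrev ite' {α : Type} (b : Bool) (x y : α) : α := Bool.rec y x b
def nsh (d : ℕ) (t : Sky) : ℕ :=
  Sky.rec (Nat.sub (nat_lit 1) (Nat.sub (nat_lit 1) d)) (fun _ d' _ ih => ite' (Nat.ble d' d) (Nat.sub (nat_lit 1) (Nat.sub (Nat.succ d') d)) ih) t
def lb (t : Sky) : ℕ :=
  Sky.rec (nat_lit 0) (fun w d t ih => Nat.add ih (Nat.add (Nat.div w d) (nsh d t))) t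
def mcons (w d : ℕ) (t : Sky) : Sky :=
  Sky.rec (cons w d nil) (fun w' d' t' _ => ite' (Nat.beq d d') (frc (Nat.succ (Nat.add w w')) fun v => cons v d t') (cons w d (cons w' d' t'))) t
def hd (t : Sky) : ℕ := Sky.rec (nat_lit 0) (fun _ d _ _ => d) t
def chain (t : Sky) : ℕ → ℕ → Bool :=
  Sky.rec (fun _ acc => Nat.beq acc (nat_lit 0))
   (fun w d _ ih dm acc => @Nat.rec (fun _ => Bool)
     (@Nat.rec (fun _ => Bool) (ih (nat_lit 0) (nat_lit 0)) (fun _ _ => ih d (Nat.mod (Nat.succ w) d)) d)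
     (fun a _ => ite' (Nat.ble dm d)
       (ite' (Nat.ble dm (Nat.add (Nat.succ a) (Nat.succ w)))
          (ih d (Nat.mod (Nat.sub (Nat.add (Nat.succ a) (Nat.succ w)) dm) d))
          (ih dm (Nat.add (Nat.succ a) (Nat.succ w))))
       (ite' (Nat.ble d (Nat.succ a)) false (ih d (Nat.mod (Nat.add (Nat.succ a) (Nat.succ w)) d)))) acc) t
def scan (t : Sky) (k : ℕ → ℕ → Sky → Sky → Bool) : ℕ → Sky → ℕ → ℕ → Sky → Sky → Bool :=
  Sky.rec (fun _ _ bw bd bp bs => k bw bd bp bs)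
    (fun w d t ih ld pre bw bd bp bs =>
      ite' (Nat.ble d ld) (ih d (cons w d pre) bw bd bp bs)
       (ite' (Nat.ble bw w) (ih d (cons w d pre) bw bd bp bs)
        (ite' (Nat.ble d (hd t)) (ih d (cons w d pre) bw bd bp bs)
          (ih d (cons w d pre) w d pre t)))) t
def fin (r : ℕ) (t : Sky) (acc : ℕ) (k : Sky → ℕ → Bool) : Bool :=
  ite' (Nat.beq acc r) (ite' (chain t (nat_lit 0) (nat_lit 0)) (k t acc) true) (k t acc)
def fin0 (r : ℕ) (t : Sky) (acc : ℕ) (k : Sky → ℕ → Bool) : Bool :=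
  frc acc fun acc => ite' (Nat.ble acc r) (fin r t acc k) true
def build (r : ℕ) (k : Sky → ℕ → Bool) (p : Sky) : Sky → ℕ → Bool :=
  Sky.rec (fun t acc => fin0 r t acc k) (fun w d _ ih t acc =>
    ih (cons w d t) (Nat.add acc (Nat.add (Nat.div w d) (nsh d t)))) p
/-- place segment between pre and t, merging left -/
def placeL (r : ℕ) (k : Sky → ℕ → Bool) (pre : Sky) (s e : ℕ) (t : Sky) (acc : ℕ) : Bool :=
  Sky.rec (build r k (cons s e nil) t acc)
   (fun w1 d1 p1 _ => ite' (Nat.beq e d1) (frc (Nat.succ (Nat.add s w1)) fun s1 => build r k (cons s1 e p1) t acc)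
      (build r k (cons s e (cons w1 d1 p1)) t acc)) pre
def placeR (r : ℕ) (k : Sky → ℕ → Bool) (pre : Sky) (w e : ℕ) (suf : Sky) (acc : ℕ) : Bool :=
  Sky.rec (placeL r k pre w e nil acc)
   (fun w1 d1 t1 _ => ite' (Nat.beq e d1) (frc (Nat.succ (Nat.add w w1)) fun s1 => frc (lb t1) fun a => placeL r k pre s1 e t1 a)
      (placeL r k pre w e (cons w1 d1 t1) acc)) suf
def child (r : ℕ) (k : Sky → ℕ → Bool) (pre : Sky) (w d : ℕ) (suf : Sky) (acc s e : ℕ) : Bool :=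
  ite' (Nat.beq s w) (placeR r k pre w e suf acc)
    (frc (Nat.sub w (Nat.succ s)) fun v => frc (Nat.add acc (Nat.succ (Nat.div v d))) fun a => placeL r k pre s e (cons v d suf) a)
def revk (r : ℕ) (k : Sky → ℕ → Bool) (b : ℕ) (p : Sky) : Sky → Bool := Sky.rec (fun t => fin r t b k) (fun w h _ ih t => ih (cons w h t)) p
def light (r : ℕ) (k : Sky → ℕ → Bool) (pre : Sky) (w d : ℕ) (suf : Sky) (s e b : ℕ) : Bool :=
  ite' (Nat.beq s w) (revk r k b pre (cons w e suf))
   (frc (Nat.sub w (Nat.succ s)) fun v => revk r k b pre (cons s e (cons v d suf)))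
def newD (D w s e : ℕ) (pre suf : Sky) : ℕ :=
  Nat.sub (Nat.sub (Nat.sub D (Sky.rec (nat_lit 1) (fun _ _ _ _ => nat_lit 0) pre))
    (Sky.rec (Nat.sub (nat_lit 1) (Nat.sub w s)) (fun _ _ _ _ => nat_lit 0) suf)) (Nat.sub (nat_lit 1) e)
def goFull (r : ℕ) (k : ℕ → ℕ → Sky → ℕ → Bool) (D M : ℕ) (pre : Sky) (w d : ℕ) (suf : Sky) (s e : ℕ) : Bool :=
  frc D fun D' => ite' (Nat.ble D' (Nat.add r (nat_lit 2)))
    (child r (k D' M) pre w d suf (lb suf) s e) true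
def goLight (r : ℕ) (k : ℕ → ℕ → Sky → ℕ → Bool) (D M : ℕ) (pre : Sky) (w d : ℕ) (suf : Sky) (s e b : ℕ) : Bool :=
  frc D fun D' => ite' (Nat.ble D' (Nat.add r (nat_lit 2)))
    (frc (Nat.lor M (Nat.shiftLeft (nat_lit 1) e)) fun M' => light r (k D' M') pre w d suf s e b) true
def node (r : ℕ) (k : ℕ → ℕ → Sky → ℕ → Bool) (D M b w d : ℕ) (pre suf : Sky) : Bool :=
  frc (Nat.div w d) fun c =>
  Nat.rec (Nat.ble (nat_lit 1) d) (fun s ihs => frc (Nat.sub d (Nat.succ s)) fun e =>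
     ite' (ite' (Nat.beq (Nat.land (Nat.shiftRight M e) (nat_lit 1)) (nat_lit 0))
        (frc (Nat.sub (Nat.add (Nat.div s e) (Nat.add b (Nat.div (Nat.add w e) d))) c) fun b' =>
          ite' (Nat.ble b' r) (goLight r k (newD D w s e pre suf) M pre w d suf s e b') true)
        (goFull r k (newD D w s e pre suf) M pre w d suf s e)) ihs false)
    (ite' (Nat.ble d w) d (Nat.succ w))
def refute (r : ℕ) : ℕ → ℕ → Sky → ℕ → Bool :=
  Nat.rec (fun _ _ _ _ => false) (fun r ih D M S b =>
    scan S (node r ih D M b) (nat_lit 0) nil (nat_lit 30) (nat_lit 0) nil nil) r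
def mask (t : Sky) : ℕ := Sky.rec (nat_lit 1) (fun _ h _ ih => Nat.lor (Nat.shiftLeft (nat_lit 1) h) ih) t
/-- the bottom row -/
def rowc (chk : Sky → Bool) (fst : ℕ) : ℕ → Sky → ℕ → Bool
  | 0, p, x => frc (28 - x) fun s => !(Nat.ble s fst) || chk (mcons s (28-s) p)
  | k+1, p, x => Nat.rec true (fun s ih => frc (28-s) fun e => frc (x+s+1) fun x' =>
      rowc chk fst k (mcons s e p) x' && ih) (28 - x)
def chk (r D : ℕ) (p : Sky) : Bool := build r (refute r D (mask p)) p nil (nat_lit 0)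
def rows (b r D lo : ℕ) (n : ℕ) : Bool := Nat.rec true (fun i ih => frc (lo+i) fun f => frc (28-f) fun e => rowc (chk r D) f b (cons f e nil) (f+1) && ih) n
end
end Sky
open Sky
namespace Sky

lemma frc_eq {α : Type} (x : ℕ) (k : ℕ → α) : frc x k = k x := by cases x <;> rfl
lemma ite'_eq {α : Type} (b : Bool) (x y : α) : ite' b x y = if b = true then x else y := by
  cases b <;> rfl

lemma nsh_nil (d) : nsh d nil = 1 - (1 - d) := rfl
lemma nsh_cons (d w d' t) : nsh d (cons w d' t) = if d' ≤ d then 1 - (d' + 1 - d) else nsh d t := by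
  change ite' (Nat.ble d' d) _ _ = _
  rw [ite'_eq]; simp only [Nat.ble_eq]; rfl
lemma nsh_le (d t) : nsh d t ≤ 1 := by
  induction t with
  | nil => rw [nsh_nil]; omega
  | cons w d' t ih => rw [nsh_cons]; split_ifs <;> omega
lemma nsh_zero (t) : nsh 0 t = 0 := by
  induction t with
  | nil => rfl
  | cons w d' t ih => rw [nsh_cons]; split_ifs <;> omega
lemma lb_nil : lb nil = 0 := rfl
lemma lb_cons (w d t) : lb (cons w d t) = lb t + (w / d + nsh d t) := rfl

def Fs : Sky → ℕ → ℕ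
  | nil, _ => 0
  | cons w d t, i => if i ≤ w then d else Fs t (i - (w + 1))
def wid : Sky → ℕ
  | nil => 0
  | cons w _ t => wid t + (w + 1)
def ok (M : ℕ) : Sky → Prop
  | nil => True
  | cons _ d t => M.testBit d = true ∧ ok M t
def app : Sky → Sky → Sky
  | nil, t => t
  | cons w d p, t => app p (cons w d t)

lemma Fs_lo {w d t i} (h : i ≤ w) : Fs (cons w d t) i = d := by simp [Fs, h]
lemma Fs_hi (w d t i) : Fs (cons w d t) (w + 1 + i) = Fs t i := by
  rw [Fs, if_neg (by omega)]; congr 1; omega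
lemma Fs_wid (t i) : Fs t (wid t + i) = 0 := by
  induction t with
  | nil => rfl
  | cons w d t ih =>
    rw [wid, show wid t + (w+1) + i = w + 1 + (wid t + i) by omega, Fs_hi, ih]
lemma Fs_app (p t i) : Fs (app p t) (wid p + i) = Fs t i := by
  induction p generalizing t i with
  | nil => simp [app, wid]
  | cons w d p ih => rw [app, wid, add_assoc, ih, Fs_hi]
lemma wid_app (p t) : wid (app p t) = wid p + wid t := by
  induction p generalizing t with
  | nil => simp [app, wid]
  | cons w d p ih => rw [app, ih, wid, wid]; omega
lemma ok_app (M p t) : ok M (app p t) ↔ ok M p ∧ ok M t := by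
  induction p generalizing t with
  | nil => simp [app, ok]
  | cons w d p ih => rw [app, ih, ok, ok]; tauto
lemma upd_app (p) {t t' a n} (h : Fs t' = upd (Fs t) a n) :
    Fs (app p t') = upd (Fs (app p t)) (wid p + a) n := by
  induction p generalizing t t' a with
  | nil => simpa [app, wid] using h
  | cons w d p ih =>
    rw [app, app, wid, add_assoc]
    apply ih
    funext i
    unfold upd
    by_cases hi : i ≤ w
    · rw [Fs_lo hi, Fs_lo hi, if_neg (by omega)]
    · obtain ⟨j, rfl⟩ : ∃ j, i = w + 1 + j := ⟨i - (w+1), by omega⟩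
      rw [Fs_hi, Fs_hi, h, upd]
      congr 1
      apply propext; constructor <;> intro <;> omega
lemma app_congr (p) {t t'} (h : Fs t' = Fs t) : Fs (app p t') = Fs (app p t) := by
  induction p generalizing t t' with
  | nil => exact h
  | cons w d p ih =>
    apply ih
    funext i
    simp only [Fs, h]
lemma Fs_merge (w w' d t) : Fs (cons (w + w' + 1) d t) = Fs (cons w d (cons w' d t)) := by
  funext i
  simp only [Fs]
  split_ifs <;> first | omega | rfl | skip
  congr 1; omega

lemma nsh_one {d t c} (h : nsh d t = 1) (hc : Fs t c = d) (hd : 0 < d) : ∃ c' < c, Fs t c' < d := by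
  induction t generalizing c with
  | nil => simp [Fs] at hc; omega
  | cons w d' t ih =>
    rw [nsh_cons] at h
    by_cases hcw : c ≤ w
    · rw [Fs_lo hcw] at hc
      subst hc
      rw [if_pos le_rfl] at h; omega
    · obtain ⟨j, rfl⟩ : ∃ j, c = w + 1 + j := ⟨c - (w+1), by omega⟩
      rw [Fs_hi] at hc
      split_ifs at h with h1
      · exact ⟨0, by omega, by rw [Fs_lo (by omega)]; omega⟩
      · obtain ⟨c', h2, h3⟩ := ih h hc
        exact ⟨w + 1 + c', by omega, by rwa [Fs_hi]⟩

lemma exists_indep (t : Sky) : ∃ C, Indep (Fs t) C ∧ lb t ≤ C.card := by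
  induction t with
  | nil => exact ⟨∅, ⟨by simp, by simp⟩, by simp [lb_nil]⟩
  | cons w d t ih =>
    obtain ⟨C, hC, hl⟩ := ih
    rcases Nat.eq_zero_or_pos d with rfl | hd
    · refine ⟨C.map (addLeftEmbedding (w+1)), ⟨?_, ?_⟩, ?_⟩
      · intro c hc
        obtain ⟨a, ha, rfl⟩ := Finset.mem_map.1 hc
        rw [addLeftEmbedding_apply, Fs_hi]; exact hC.1 a ha
      · intro c hc c' hc'
        obtain ⟨a, ha, rfl⟩ := Finset.mem_map.1 hc
        obtain ⟨a', ha', rfl⟩ := Finset.mem_map.1 hc'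
        simp only [addLeftEmbedding_apply, Fs_hi]
        intro h1 h2
        rcases hC.2 a ha a' ha' (by omega) h2 with h3 | ⟨c, h3, h4, h5⟩
        · left; omega
        · right; exact ⟨w + 1 + c, by omega, by omega, by rwa [Fs_hi]⟩
      · rw [Finset.card_map, lb_cons, nsh_zero]; simpa using hl
    · have hn := nsh_le d t
      set m := w / d + nsh d t with hm
      have hmd : w / d * d ≤ w := Nat.div_mul_le_self w d
      have hkw : ∀ k < m, k * d ≤ w := by
        intro k hk
        have : k * d ≤ w / d * d := Nat.mul_le_mul_right d (by omega)
        omega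
      refine ⟨(Finset.range m).image (· * d) ∪ C.map (addLeftEmbedding (w+1)), ⟨?_, ?_⟩, ?_⟩
      · intro c hc
        rcases Finset.mem_union.1 hc with hc | hc
        · obtain ⟨k, hk, rfl⟩ := Finset.mem_image.1 hc
          rw [Fs_lo (hkw k (Finset.mem_range.1 hk))]; exact hd
        · obtain ⟨a, ha, rfl⟩ := Finset.mem_map.1 hc
          rw [addLeftEmbedding_apply, Fs_hi]; exact hC.1 a ha
      · intro c hc c' hc'
        rcases Finset.mem_union.1 hc with hc | hc <;> rcases Finset.mem_union.1 hc' with hc' | hc'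
        · obtain ⟨k, hk, rfl⟩ := Finset.mem_image.1 hc
          obtain ⟨k', hk', rfl⟩ := Finset.mem_image.1 hc'
          rw [Fs_lo (hkw k (Finset.mem_range.1 hk))]
          intro h1 _
          left
          have h2 : k < k' := lt_of_mul_lt_mul_right h1 (Nat.zero_le d)
          have : (k + 1) * d ≤ k' * d := Nat.mul_le_mul_right d h2
          linarith
        · obtain ⟨k, hk, rfl⟩ := Finset.mem_image.1 hc
          obtain ⟨a, ha, rfl⟩ := Finset.mem_map.1 hc'
          have hk := Finset.mem_range.1 hk
          have := hkw k hk
          simp only [addLeftEmbedding_apply, Fs_hi]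
          rw [Fs_lo this]
          intro _ h2
          rcases Nat.lt_or_ge (nsh d t) 1 with h3 | h3
          · left
            have : (k + 1) * d ≤ w / d * d := Nat.mul_le_mul_right d (by omega)
            have : (k + 1) * d = k * d + d := by ring
            omega
          · right
            obtain ⟨c', h4, h5⟩ := nsh_one (by omega) h2.symm hd
            exact ⟨w + 1 + c', by omega, by omega, by rwa [Fs_hi]⟩
        · obtain ⟨k, hk, rfl⟩ := Finset.mem_image.1 hc'
          obtain ⟨a, ha, rfl⟩ := Finset.mem_map.1 hc
          have hk := hkw k (Finset.mem_range.1 hk)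
          simp only [addLeftEmbedding_apply]
          intro h1; omega
        · obtain ⟨a, ha, rfl⟩ := Finset.mem_map.1 hc
          obtain ⟨a', ha', rfl⟩ := Finset.mem_map.1 hc'
          simp only [addLeftEmbedding_apply, Fs_hi]
          intro h1 h2
          rcases hC.2 a ha a' ha' (by omega) h2 with h3 | ⟨c, h3, h4, h5⟩
          · left; omega
          · right; exact ⟨w + 1 + c, by omega, by omega, by rwa [Fs_hi]⟩
      · rw [Finset.card_union_of_disjoint, Finset.card_map, Finset.card_image_of_injective,
          Finset.card_range, lb_cons]
        · omega
        · intro a b hab; exact Nat.eq_of_mul_eq_mul_right hd hab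
        · rw [Finset.disjoint_left]
          intro c hc hc'
          obtain ⟨k, hk, rfl⟩ := Finset.mem_image.1 hc
          obtain ⟨a, ha, h1⟩ := Finset.mem_map.1 hc'
          have hk := hkw k (Finset.mem_range.1 hk)
          simp only [addLeftEmbedding_apply] at h1
          omega

open Classical in
lemma lb_floor {t R} (h : Fill (Fs t) R) : lb t ≤ (R.filter (Floor (Fs t))).card := by
  obtain ⟨C, hC, hl⟩ := exists_indep t
  exact hl.trans (h.lbound hC)

lemma lb_card {t R} (h : Fill (Fs t) R) : lb t ≤ R.card := by
  classical
  exact (lb_floor h).trans (Finset.card_filter_le _ _)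
lemma hd_nil : hd nil = 0 := rfl
lemma hd_cons (w d t) : hd (cons w d t) = d := rfl
lemma chain_nil (dm acc) : chain nil dm acc = Nat.beq acc 0 := rfl
lemma chain_z (w t dm) : chain (cons w 0 t) dm 0 = chain t 0 0 := rfl
lemma chain_p (w d t dm) : chain (cons w (d+1) t) dm 0 = chain t (d+1) ((w+1) % (d+1)) := rfl
lemma chain_s (w d t dm a) : chain (cons w d t) dm (a+1) =
    if dm ≤ d then
      if dm ≤ a + 1 + (w + 1) then chain t d ((a + 1 + (w + 1) - dm) % d)
      else chain t dm (a + 1 + (w + 1))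
    else if d ≤ a + 1 then false else chain t d ((a + 1 + (w + 1)) % d) := by
  change ite' (Nat.ble dm d) (ite' (Nat.ble dm (a + 1 + (w + 1)))
    (chain t d ((a + 1 + (w + 1) - dm) % d)) (chain t dm (a + 1 + (w + 1))))
    (ite' (Nat.ble d (a+1)) false (chain t d ((a + 1 + (w + 1)) % d))) = _
  simp only [ite'_eq, Nat.ble_eq]

def Bdry (R : Finset (ℕ × ℕ × ℕ)) (X : ℕ) : Prop :=
  ∀ q ∈ R, q.2.1 = 0 → q.1 < X → q.1 + q.2.2 ≤ X

def State (F : ℕ → ℕ) (R : Finset (ℕ × ℕ × ℕ)) (X dm acc : ℕ) : Prop :=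
  (acc = 0 ∧ Bdry R X) ∨ (0 < acc ∧ ∃ q ∈ R, q.2.1 = 0 ∧ q.1 + acc = X ∧ acc < q.2.2 ∧ q.2.2 ≤ dm ∧
    ∀ c, q.1 ≤ c → c < X → dm ≤ F c)

lemma bdry_of {F R} (h : Fill F R) {q} (hq : q ∈ R) (h0 : q.2.1 = 0) : Bdry R (q.1 + q.2.2) := by
  intro q' hq' h0' hlt
  by_contra hc
  have p1 := h.pos q hq
  have p2 := h.pos q' hq'
  have := h.unq q hq q' hq' (max q.1 q'.1) 0 ⟨by omega, by omega, by omega, by omega⟩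
    ⟨by omega, by omega, by omega, by omega⟩
  subst this; omega

lemma state_seg {F R} (h : Fill F R) (hfl : ∀ q ∈ R, q.2.1 = 0 → Floor F q) {d} (hd : 0 < d) :
    ∀ W X, Bdry R X → (∀ c, X ≤ c → c < X + W → F c = d) → State F R (X + W) d (W % d) := by
  intro W
  induction W using Nat.strong_induction_on with
  | _ W ih =>
  intro X hB hF
  rcases Nat.eq_zero_or_pos W with rfl | hW
  · left; simpa using hB
  have hFX := hF X le_rfl (by omega)
  obtain ⟨q, hq, c1, c2, c3, c4⟩ := h.cov X 0 (by omega)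
  have hy : q.2.1 = 0 := by omega
  have hx : q.1 = X := by
    by_contra hne
    have := hB q hq hy (by omega)
    omega
  have hqd := h.inn q hq X c1 c2
  have hend : q.2.2 ≤ W → q.2.2 = d := by
    intro hle
    obtain ⟨c, e1, e2, e3⟩ := hfl q hq hy
    have := hF c (by omega) (by omega)
    omega
  rcases Nat.lt_or_ge W d with hlt | hge
  · right
    rw [Nat.mod_eq_of_lt hlt]
    refine ⟨hW, q, hq, hy, by omega, ?_, by omega, ?_⟩
    · by_contra; have := hend (by omega); omega
    · intro c e1 e2; rw [hF c (by omega) (by omega)]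
  · have hqe := hend (by omega)
    have hb := bdry_of h hq hy
    rw [hx, hqe] at hb
    have := ih (W - d) (by omega) (X + d) hb (fun c e1 e2 => hF c (by omega) (by omega))
    rw [Nat.mod_eq_sub_mod hge]
    rwa [show X + d + (W - d) = X + W by omega] at this

lemma chain_sound {F R} (h : Fill F R) (hfl : ∀ q ∈ R, q.2.1 = 0 → Floor F q) (t : Sky) :
    ∀ X dm acc, (∀ i, F (X + i) = Fs t i) → State F R X dm acc → chain t dm acc = true := by
  induction t with
  | nil =>
    intro X dm acc hF hS
    rw [chain_nil]
    rcases hS with ⟨rfl, _⟩ | ⟨h1, q, hq, h2, h3, h4, h5, h6⟩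
    · rfl
    · have := h.inn q hq X (by omega) (by omega)
      have h7 := hF 0
      simp only [Fs, add_zero] at h7
      omega
  | cons w d t ih =>
    intro X dm acc hF hS
    have hd : ∀ c, X ≤ c → c < X + (w + 1) → F c = d := by
      intro c h1 h2
      have := hF (c - X)
      rwa [show X + (c - X) = c by omega, Fs_lo (by omega)] at this
    have ht : ∀ i, F (X + (w + 1) + i) = Fs t i := by
      intro i; rw [← Fs_hi w d t i, ← hF]; congr 1; omega
    rcases hS with ⟨rfl, hB⟩ | ⟨h1, q, hq, h2, h3, h4, h5, h6⟩
    · cases d with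
      | zero =>
        rw [chain_z]
        apply ih _ _ _ ht
        left
        refine ⟨rfl, ?_⟩
        intro q hq h0 hlt
        rcases Nat.lt_or_ge q.1 X with hx | hx
        · have := hB q hq h0 hx; omega
        · have h1 := h.pos q hq
          have := h.inn q hq q.1 le_rfl (by omega)
          have := hd q.1 hx hlt
          omega
      | succ d =>
        rw [chain_p]
        exact ih _ _ _ ht (state_seg h hfl (by omega) (w+1) X hB hd)
    · obtain ⟨a, rfl⟩ : ∃ a, acc = a + 1 := ⟨acc - 1, by omega⟩
      rw [chain_s]
      have hX := hd X le_rfl (by omega)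
      have hqX := h.inn q hq X (by omega) (by omega)
      have hend : q.2.2 ≤ a + 1 + (w + 1) → q.2.2 = dm ∨ q.2.2 = d := by
        intro hle
        obtain ⟨c, e1, e2, e3⟩ := hfl q hq h2
        have := hd c
        have := h6 c e1
        omega
      have hb := bdry_of h hq h2
      split_ifs with g1 g2 g3
      · have hqd : q.2.2 = dm := by have := hend; omega
        apply ih _ _ _ ht
        have := state_seg h hfl (d := d) (by omega) (a + 1 + (w + 1) - dm) (q.1 + q.2.2) hb
          (fun c e1 e2 => hd c (by omega) (by omega))
        rwa [show q.1 + q.2.2 + (a + 1 + (w + 1) - dm) = X + (w + 1) by omega] at this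
      · apply ih _ _ _ ht
        right
        refine ⟨by omega, q, hq, h2, by omega, by omega, h5, ?_⟩
        intro c e1 e2
        have := hd c
        have := h6 c e1
        omega
      · omega
      · apply ih _ _ _ ht
        rcases Nat.lt_or_ge (a + 1 + (w + 1)) d with g4 | g4
        · right
          rw [Nat.mod_eq_of_lt g4]
          refine ⟨by omega, q, hq, h2, by omega, by omega, by omega, ?_⟩
          intro c e1 e2
          have := hd c
          have := h6 c e1
          omega
        · have hqd : q.2.2 = d := by have := hend; omega
          have := state_seg h hfl (d := d) (by omega) (a + 1 + (w + 1) - d) (q.1 + q.2.2) hb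
            (fun c e1 e2 => hd c (by omega) (by omega))
          rw [Nat.mod_eq_sub_mod g4]
          rwa [show q.1 + q.2.2 + (a + 1 + (w + 1) - d) = X + (w + 1) by omega] at this

lemma chain_card {t R r} (h : Fill (Fs t) R) (hr : r ≤ lb t) (hc : R.card ≤ r) :
    chain t 0 0 = true := by
  classical
  have h1 := lb_floor h
  have h2 : R.filter (Floor (Fs t)) = R :=
    Finset.eq_of_subset_of_card_le (Finset.filter_subset _ _) (by omega)
  apply chain_sound h _ t 0 0 0 (fun i => by rw [zero_add])
  · left; exact ⟨rfl, fun q _ _ hlt => by omega⟩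
  · intro q hq _
    rw [← h2] at hq
    exact (Finset.mem_filter.1 hq).2
lemma fin_sound {r t acc k R} (hk : fin r t acc k = true) (hl : acc ≤ lb t) (h : Fill (Fs t) R)
    (hc : R.card ≤ r) : k t acc = true := by
  unfold fin at hk
  simp only [ite'_eq, Nat.beq_eq] at hk
  split_ifs at hk with h1 h2
  · exact hk
  · exact absurd (chain_card h (r := r) (by omega) hc) h2
  · exact hk

lemma fin0_sound {r t acc k R} (hk : fin0 r t acc k = true) (hl : acc ≤ lb t) (h : Fill (Fs t) R)
    (hc : R.card ≤ r) : k t acc = true := by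
  unfold fin0 at hk
  simp only [frc_eq, ite'_eq, Nat.ble_eq] at hk
  split_ifs at hk with h1
  · exact fin_sound hk hl h hc
  · have := lb_card h; omega

lemma build_sound {r k R} (p) : ∀ t acc, build r k p t acc = true → acc ≤ lb t →
    Fill (Fs (app p t)) R → R.card ≤ r → ∃ b ≤ lb (app p t), k (app p t) b = true := by
  induction p with
  | nil => intro t acc hk hl h hc; exact ⟨acc, hl, fin0_sound hk hl h hc⟩
  | cons w d p ih =>
    intro t acc hk hl h hc
    exact ih (cons w d t) (acc + (w / d + nsh d t)) hk (by rw [lb_cons]; omega) h hc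

lemma revk_sound {r k b R} (p) : ∀ t, revk r k b p t = true → b ≤ lb (app p t) →
    Fill (Fs (app p t)) R → R.card ≤ r → k (app p t) b = true := by
  induction p with
  | nil => intro t hk hl h hc; exact fin_sound hk hl h hc
  | cons w d p ih => intro t hk hl h hc; exact ih (cons w d t) hk hl h hc

def Res (k : Sky → ℕ → Bool) (G : Sky) : Prop :=
  ∃ S b, Fs S = Fs G ∧ wid S = wid G ∧ (∀ M, ok M G → ok M S) ∧ b ≤ lb S ∧ k S b = true

lemma Res.congr {k G G'} (h : Res k G) (h1 : Fs G = Fs G') (h2 : wid G = wid G')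
    (h3 : ∀ M, ok M G' → ok M G) : Res k G' := by
  obtain ⟨S, b, a1, a2, a3, a4, a5⟩ := h
  exact ⟨S, b, a1.trans h1, a2.trans h2, fun M hM => a3 M (h3 M hM), a4, a5⟩

lemma build_res {r k p t acc R} (hk : build r k p t acc = true) (hl : acc ≤ lb t)
    (h : Fill (Fs (app p t)) R) (hc : R.card ≤ r) : Res k (app p t) := by
  obtain ⟨b, h1, h2⟩ := build_sound p t acc hk hl h hc
  exact ⟨_, b, rfl, rfl, fun _ h => h, h1, h2⟩

lemma placeL_res {r k pre s e t acc R} (hk : placeL r k pre s e t acc = true) (hl : acc ≤ lb t)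
    (h : Fill (Fs (app pre (cons s e t))) R) (hc : R.card ≤ r) :
    Res k (app pre (cons s e t)) := by
  cases pre with
  | nil => exact build_res (p := cons s e nil) hk hl h hc
  | cons w1 d1 p1 =>
    change ite' (Nat.beq e d1) (frc (s + w1 + 1) fun s1 => build r k (cons s1 e p1) t acc)
      (build r k (cons s e (cons w1 d1 p1)) t acc) = true at hk
    simp only [ite'_eq, frc_eq, Nat.beq_eq] at hk
    split_ifs at hk with h1
    · subst h1
      have hF : Fs (app (cons (s + w1 + 1) e p1) t) = Fs (app (cons w1 e p1) (cons s e t)) := by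
        rw [app, app]; apply app_congr; rw [← Fs_merge, Nat.add_comm s w1]
      refine (build_res hk hl (by rw [hF]; exact h) hc).congr hF ?_ ?_
      · simp only [wid_app, wid]; omega
      · intro M; simp only [ok_app, ok]; tauto
    · exact build_res (p := cons s e (cons w1 d1 p1)) hk hl h hc

lemma placeR_res {r k pre w e suf acc R} (hk : placeR r k pre w e suf acc = true)
    (hl : acc ≤ lb suf) (h : Fill (Fs (app pre (cons w e suf))) R) (hc : R.card ≤ r) :
    Res k (app pre (cons w e suf)) := by
  cases suf with
  | nil => exact placeL_res hk hl h hc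
  | cons w1 d1 t1 =>
    change ite' (Nat.beq e d1) (frc (w + w1 + 1) fun s1 => frc (lb t1) fun a =>
      placeL r k pre s1 e t1 a) (placeL r k pre w e (cons w1 d1 t1) acc) = true at hk
    simp only [ite'_eq, frc_eq, Nat.beq_eq] at hk
    split_ifs at hk with h1
    · subst h1
      have hF : Fs (app pre (cons (w + w1 + 1) e t1)) = Fs (app pre (cons w e (cons w1 e t1))) := by
        apply app_congr; rw [← Fs_merge]
      refine (placeL_res hk le_rfl (by rw [hF]; exact h) hc).congr hF ?_ ?_
      · simp only [wid_app, wid]; omega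
      · intro M; simp only [ok_app, ok]; tauto
    · exact placeL_res hk hl h hc

def tgt (w d : ℕ) (suf : Sky) (s e : ℕ) : Sky :=
  if s = w then cons w e suf else cons s e (cons (w - (s + 1)) d suf)

lemma nsh_peak {d t} (h : hd t < d) : nsh d t = 1 := by
  cases t with
  | nil => rw [nsh_nil]; omega
  | cons w d' t => rw [hd_cons] at h; rw [nsh_cons, if_pos (by omega)]; omega

lemma child_res {r k pre w d suf s e R} (hk : child r k pre w d suf (lb suf) s e = true)
    (hp : hd suf < d)
    (h : Fill (Fs (app pre (tgt w d suf s e))) R) (hc : R.card ≤ r) :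
    Res k (app pre (tgt w d suf s e)) := by
  unfold child at hk
  unfold tgt at *
  simp only [ite'_eq, frc_eq, Nat.beq_eq] at hk
  split_ifs at * with h1
  · exact placeR_res hk le_rfl h hc
  · refine placeL_res hk ?_ h hc
    rw [lb_cons, nsh_peak hp]
    exact le_rfl

lemma nsh_absent {M e t} (h : ok M t) (he : M.testBit e = false) (h0 : 0 < e) : nsh e t = 1 := by
  induction t with
  | nil => rw [nsh_nil]; omega
  | cons w d t ih =>
    rw [nsh_cons]
    have : d ≠ e := by rintro rfl; rw [h.1] at he; cases he
    split_ifs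
    · omega
    · exact ih h.2

lemma lb_app_mono {M x y} (pre) : ∀ t t', ok M pre →
    (∀ d0, M.testBit d0 = true → nsh d0 t ≤ nsh d0 t') → lb t + x ≤ lb t' + y →
    lb (app pre t) + x ≤ lb (app pre t') + y := by
  induction pre with
  | nil => intro t t' _ _ h; exact h
  | cons w d p ih =>
    intro t t' ho hn hl
    apply ih _ _ ho.2
    · intro d0 h0
      have := hn d0 h0
      rw [nsh_cons, nsh_cons]; split_ifs <;> omega
    · have := hn d ho.1
      rw [lb_cons, lb_cons]; omega

lemma light_lb {M pre w d suf s e b} (hM : ok M (app pre (cons w d suf))) (he : M.testBit e = false)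
    (h0 : M.testBit 0 = true) (hb : b ≤ lb (app pre (cons w d suf))) (hp : hd suf < d)
    (hde : d = e + (s + 1)) (hs : s ≤ w) :
    s / e + (b + (w + e) / d) - w / d ≤ lb (app pre (tgt w d suf s e)) := by
  rw [ok_app] at hM
  have he0 : 0 < e := by
    rcases Nat.eq_zero_or_pos e with rfl | h
    · rw [h0] at he; cases he
    · exact h
  have hsuf := nsh_absent hM.2.2 he he0
  have hpk := nsh_peak hp
  have := lb_app_mono (M := M) (x := s / e + (w + e) / d) (y := w / d) pre (cons w d suf)
    (tgt w d suf s e) hM.1 ?_ ?_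
  · omega
  · intro d0 hd0
    have hne : d0 ≠ e := by rintro rfl; rw [hd0] at he; cases he
    have h1 := nsh_le d0 suf
    have : nsh d0 (cons w d suf) ≤ 1 := nsh_le _ _
    unfold tgt
    rcases Nat.lt_or_ge e d0 with h2 | h2
    · split_ifs
      · rw [nsh_cons d0 w e, if_pos (by omega)]; omega
      · rw [nsh_cons d0 s e, if_pos (by omega)]; omega
    · split_ifs
      · rw [nsh_cons, nsh_cons, if_neg (by omega), if_neg (by omega)]
      · rw [nsh_cons, nsh_cons, nsh_cons, if_neg (by omega), if_neg (by omega)]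
  · unfold tgt
    split_ifs with h1
    · subst h1
      rw [lb_cons, lb_cons, hsuf, hpk, Nat.div_eq_of_lt (show s + e < d by omega)]; omega
    · rw [lb_cons, lb_cons, lb_cons, nsh_cons, if_neg (by omega), hsuf, hpk]
      have : (w + e) / d = (w - (s + 1)) / d + 1 := by
        rw [← Nat.add_div_right _ (by omega)]; congr 1; omega
      omega

lemma light_res {r k pre w d suf s e b R} (hk : light r k pre w d suf s e b = true)
    (hb : b ≤ lb (app pre (tgt w d suf s e)))
    (h : Fill (Fs (app pre (tgt w d suf s e))) R) (hc : R.card ≤ r) :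
    Res k (app pre (tgt w d suf s e)) := by
  unfold light at hk
  refine ⟨_, b, rfl, rfl, fun _ h => h, hb, ?_⟩
  unfold tgt at *
  simp only [ite'_eq, frc_eq, Nat.beq_eq] at hk
  split_ifs at * with h1
  · exact revk_sound _ _ hk hb h hc
  · exact revk_sound _ _ hk hb h hc

def Peak (S : Sky) (w d : ℕ) (pre suf : Sky) : Prop :=
  (d = 0) ∨ (app pre (cons w d suf) = S ∧ hd suf < d ∧ hd pre < d)

lemma scan_nil (k a b c d e f) : scan nil k a b c d e f = k c d e f := rfl
lemma scan_cons (w d t k ld pre bw bd bp bs) : scan (cons w d t) k ld pre bw bd bp bs =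
    if d ≤ ld then scan t k d (cons w d pre) bw bd bp bs
    else if bw ≤ w then scan t k d (cons w d pre) bw bd bp bs
    else if d ≤ hd t then scan t k d (cons w d pre) bw bd bp bs
    else scan t k d (cons w d pre) w d pre t := by
  change ite' (Nat.ble d ld) (scan t k d (cons w d pre) bw bd bp bs)
    (ite' (Nat.ble bw w) (scan t k d (cons w d pre) bw bd bp bs)
    (ite' (Nat.ble d (hd t)) (scan t k d (cons w d pre) bw bd bp bs)
      (scan t k d (cons w d pre) w d pre t))) = _
  simp only [ite'_eq, Nat.ble_eq]

lemma scan_sound {k : ℕ → ℕ → Sky → Sky → Bool} {S} (t) : ∀ pre bw bd bp bs,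
    scan t k (hd pre) pre bw bd bp bs = true → app pre t = S → Peak S bw bd bp bs →
    ∃ w d p s, Peak S w d p s ∧ k w d p s = true := by
  induction t with
  | nil => intro pre bw bd bp bs hk _ hP; exact ⟨_, _, _, _, hP, hk⟩
  | cons w d t ih =>
    intro pre bw bd bp bs hk hS hP
    rw [scan_cons] at hk
    split_ifs at hk
    · exact ih (cons w d pre) _ _ _ _ hk hS hP
    · exact ih (cons w d pre) _ _ _ _ hk hS hP
    · exact ih (cons w d pre) _ _ _ _ hk hS hP
    · exact ih (cons w d pre) _ _ _ _ hk hS (Or.inr ⟨hS, by omega, by omega⟩)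

lemma loop_sound {X : ℕ → ℕ → Bool} {g : ℕ → ℕ} {b0 : Bool} (n) :
    (Nat.rec b0 (fun s ihs => frc (g s) fun e => ite' (X s e) ihs false) n : Bool) = true →
    b0 = true ∧ ∀ s < n, X s (g s) = true := by
  induction n with
  | zero => intro h; exact ⟨h, by omega⟩
  | succ n ih =>
    intro h
    change frc (g n) (fun e => ite' (X n e)
      (Nat.rec b0 (fun s ihs => frc (g s) fun e => ite' (X s e) ihs false) n) false) = true at h
    rw [frc_eq, ite'_eq] at h
    split_ifs at h with h1
    obtain ⟨h2, h3⟩ := ih h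
    refine ⟨h2, fun s hs => ?_⟩
    rcases Nat.lt_succ_iff_lt_or_eq.1 hs with h | rfl
    · exact h3 s h
    · exact h1

lemma newD_le {D w s e pre suf} (hs : s ≤ w) (hw : wid (app pre (cons w (e + (s+1)) suf)) = 29) :
    newD D w s e pre suf ≤ D - touch (wid pre, e, s + 1) := by
  rw [wid_app, wid] at hw
  have key : newD D w s e pre suf = D - (if wid pre = 0 then 1 else 0)
      - (if wid suf = 0 then (1 - (w - s)) else 0) - (1 - e) := by
    cases pre <;> cases suf <;> simp only [wid] <;> simp <;> rfl
  rw [key]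
  unfold touch
  simp only
  split_ifs <;> omega

lemma upd_tgt {w d suf s e} (hde : d = e + (s + 1)) (hs : s ≤ w) :
    Fs (tgt w d suf s e) = upd (Fs (cons w d suf)) 0 (s + 1) := by
  funext i
  unfold tgt upd
  split_ifs with h1 h2 h2
  · rw [Fs_lo (by omega), Fs_lo (by omega)]; omega
  · rw [Fs, Fs, if_neg (by omega), if_neg (by omega)]
  · rw [Fs_lo (by omega), Fs_lo (by omega)]; omega
  · rw [Fs, if_neg (by omega), Fs, Fs]
    split_ifs <;> first | omega | rfl | skip
    congr 1; omega

theorem refute_sound (r : ℕ) : ∀ D M S b, refute r D M S b = true → wid S = 29 → ok M S →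
    M.testBit 0 = true → b ≤ lb S → ¬ Fills (Fs S) r D := by
  induction r with
  | zero => intro D M S b h; cases h
  | succ r ih =>
    rintro D M S b hk hw ho h0 hb ⟨R, hR, hcard, hD⟩
    change scan S (node r (refute r) D M b) (hd nil) nil 30 0 nil nil = true at hk
    obtain ⟨w, d, pre, suf, hP, hn⟩ := scan_sound S nil _ _ _ _ hk rfl (Or.inl rfl)
    unfold node at hn
    rw [frc_eq] at hn
    obtain ⟨hd1, hn⟩ := loop_sound _ hn
    have hd1 : 1 ≤ d := by simpa using hd1
    rcases hP with rfl | ⟨rfl, hp1, hp2⟩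
    · omega
    have hstep := hR.step (p := wid pre) (w := w + 1) (d := d) (by omega) hd1 ?_ ?_ ?_
    rotate_left
    · intro c h1 h2
      obtain ⟨i, rfl⟩ : ∃ i, c = wid pre + i := ⟨c - wid pre, by omega⟩
      rw [Fs_app, Fs_lo (by omega)]
    · intro c hc
      cases pre with
      | nil => simp [wid] at hc
      | cons w0 d0 p0 =>
        rw [wid] at hc
        obtain rfl : c = wid p0 + w0 := by omega
        rw [app, Fs_app, Fs_lo le_rfl]
        exact hp2
    · rw [Fs_app, ← Nat.add_zero (w + 1), Fs_hi]
      cases suf with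
      | nil => exact hp1
      | cons w0 d0 p0 => rw [Fs_lo (by omega)]; exact hp1
    obtain ⟨s', hs1, hs2, hs3, hq, hF⟩ := hstep
    obtain ⟨s, rfl⟩ : ∃ s, s' = s + 1 := ⟨s' - 1, by omega⟩
    obtain ⟨e, rfl⟩ : ∃ e, d = e + (s + 1) := ⟨d - (s + 1), by omega⟩
    rw [Nat.add_sub_cancel] at hq hF
    have hX := hn s (by simp only [ite'_eq, Nat.ble_eq]; split_ifs <;> omega)
    set d := e + (s + 1) with hde
    have hsub : Nat.sub d (Nat.succ s) = e := by change d - (s + 1) = e; omega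
    rw [hsub] at hX
    have hupd : Fs (app pre (tgt w d suf s e)) = upd (Fs (app pre (cons w d suf))) (wid pre) (s + 1) :=
      upd_app pre (upd_tgt hde (by omega))
    rw [← hupd] at hF
    have hDl := newD_le (D := D) (w := w) (s := s) (e := e) (pre := pre) (suf := suf) (by omega) hw
    have hsum := Finset.add_sum_erase R touch hq
    have hcard' := Finset.card_erase_of_mem hq
    have hdb := hF.dbound
    have hpos : 0 < R.card := Finset.card_pos.2 ⟨_, hq⟩
    have hcr : (R.erase (wid pre, e, s + 1)).card ≤ r := by omega
    have hwt : wid (app pre (tgt w d suf s e)) = 29 := by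
      rw [← hw, wid_app, wid_app]; unfold tgt; split_ifs <;> simp only [wid] <;> omega
    have hot : ∀ M', ok M' (app pre (cons w d suf)) → M'.testBit e = true →
        ok M' (app pre (tgt w d suf s e)) := by
      intro M' h1 h2
      rw [ok_app] at *
      refine ⟨h1.1, ?_⟩
      unfold tgt; split_ifs
      · exact ⟨h2, h1.2.2⟩
      · exact ⟨h2, h1.2.1, h1.2.2⟩
    have fini : ∀ D' M', D' = newD D w s e pre suf → ok M' (app pre (tgt w d suf s e)) →
        M'.testBit 0 = true → Res (refute r D' M') (app pre (tgt w d suf s e)) → False := by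
      rintro D' M' rfl h1 h2 ⟨S', b', a1, a2, a3, a4, a5⟩
      refine ih _ M' S' b' a5 (a2.trans hwt) (a3 _ h1) h2 a4 ?_
      rw [a1]
      exact ⟨_, hF, hcr, by omega⟩
    have hbit : (Nat.beq (Nat.land (Nat.shiftRight M e) 1) 0 = true) ↔ M.testBit e = false := by
      rw [Nat.beq_eq]
      change (M >>> e) &&& 1 = 0 ↔ _
      unfold Nat.testBit
      rw [Nat.land_comm]
      simp
    rw [ite'_eq] at hX
    split_ifs at hX with hm
    · rw [hbit] at hm
      have hlb := light_lb ho hm h0 hb hp1 hde (by omega)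
      rw [frc_eq, ite'_eq] at hX
      have hlc := lb_card hF
      split_ifs at hX with h1
      · unfold goLight at hX
        simp only [frc_eq, ite'_eq] at hX
        split_ifs at hX with h2
        · have hor : ∀ n, (Nat.lor M (Nat.shiftLeft 1 e)).testBit n = (M.testBit n || (1 <<< e).testBit n) :=
            fun n => Nat.testBit_lor M (1 <<< e) n
          have hok : ∀ t, ok M t → ok (Nat.lor M (Nat.shiftLeft 1 e)) t := by
            intro t; induction t with
            | nil => exact fun h => h
            | cons w d t ih => exact fun h => ⟨by rw [hor, h.1]; rfl, ih h.2⟩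
          refine fini _ _ rfl (hot _ (hok _ ho) ?_) ?_ (light_res hX hlb hF hcr)
          · rw [hor]; simp [Nat.testBit_shiftLeft]
          · rw [hor, h0]; rfl
        · apply h2; rw [Nat.ble_eq]; change _ ≤ r + 2; omega
      · apply h1; rw [Nat.ble_eq]; exact hlb.trans (hlc.trans hcr)
    · rw [hbit, Bool.not_eq_false] at hm
      unfold goFull at hX
      simp only [frc_eq, ite'_eq] at hX
      split_ifs at hX with h2
      · exact fini _ _ rfl (hot _ ho hm) h0 (child_res hX hp1 hF hcr)
      · apply h2; rw [Nat.ble_eq]; change _ ≤ r + 2; omega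
lemma ok_mask (p : Sky) : ok (mask p) p ∧ (mask p).testBit 0 = true := by
  have hmono : ∀ (a M : ℕ) t, ok M t → ok (a ||| M) t := by
    intro a M t
    induction t with
    | nil => exact fun h => h
    | cons w d t ih => exact fun h => ⟨by rw [Nat.testBit_or, h.1, Bool.or_true], ih h.2⟩
  induction p with
  | nil => exact ⟨trivial, rfl⟩
  | cons w d p ih =>
    change ok (1 <<< d ||| mask p) _ ∧ Nat.testBit (1 <<< d ||| mask p) 0 = true
    refine ⟨⟨?_, hmono _ _ _ ih.1⟩, ?_⟩
    · rw [Nat.testBit_or]; simp [Nat.testBit_shiftLeft]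
    · rw [Nat.testBit_or, ih.2, Bool.or_true]

lemma chk_sound {r D p R} (hk : chk r D p = true) (hw : wid p = 29) (h : Fill (Fs (app p nil)) R)
    (hc : R.card ≤ r) (hD : D ≤ ∑ q ∈ R, touch q) : False := by
  obtain ⟨b, h1, h2⟩ := build_sound p nil 0 hk (Nat.zero_le _) h hc
  have hm := ok_mask p
  exact refute_sound r D (mask p) _ b h2 (by rw [wid_app, hw]; rfl)
    ((ok_app _ _ _).2 ⟨hm.1, trivial⟩) hm.2 h1 ⟨R, h, hc, hD⟩

lemma mcons_nil (w d) : mcons w d nil = cons w d nil := rfl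
lemma mcons_cons (w d w' d' t) : mcons w d (cons w' d' t) =
    if d = d' then cons (w + w' + 1) d t else cons w d (cons w' d' t) := by
  change ite' (Nat.beq d d') (frc (w + w' + 1) fun v => cons v d t) _ = _
  simp only [ite'_eq, frc_eq, Nat.beq_eq]
lemma wid_mcons (w d t) : wid (mcons w d t) = wid t + (w + 1) := by
  cases t with
  | nil => rfl
  | cons w' d' t => rw [mcons_cons]; split_ifs <;> simp only [wid] <;> omega
lemma hd_mcons (w d t) : hd (mcons w d t) = d := by
  cases t with
  | nil => rfl
  | cons w' d' t => rw [mcons_cons]; split_ifs <;> rfl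
lemma Fs_mcons (w d p t) : Fs (app (mcons w d p) t) = Fs (app p (cons w d t)) := by
  cases p with
  | nil => rfl
  | cons w' d' p =>
    rw [mcons_cons]; split_ifs with h
    · subst h
      rw [app, app]; apply app_congr; rw [← Fs_merge, Nat.add_comm w w']
    · rfl

lemma rowc_zero (c fst p x) : rowc c fst 0 p x = (!(Nat.ble (28 - x) fst) || c (mcons (28 - x) (28 - (28 - x)) p)) := by
  rw [rowc, frc_eq]
lemma rowc_succ (c fst k p x) : rowc c fst (k+1) p x = true ↔
    ∀ s < 28 - x, rowc c fst k (mcons s (28 - s) p) (x + s + 1) = true := by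
  rw [rowc]
  generalize 28 - x = n
  induction n with
  | zero => simp
  | succ n ih =>
    simp only [frc_eq] at ih ⊢
    rw [Bool.and_eq_true, ih, Nat.forall_lt_succ_right]
    exact and_comm

/-- One step of the row. -/
lemma row_step {p x R} (hw : wid p = x) (hx : x ≤ 28) (hp : hd p < 29)
    (h : Fill (Fs (app p (cons (28 - x) 29 nil))) R) :
    ∃ s ≤ 28 - x, s < 28 ∧ (x, 28 - s, s + 1) ∈ R ∧
      Fill (Fs (app p (tgt (28 - x) 29 nil s (28 - s)))) (R.erase (x, 28 - s, s + 1)) := by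
  subst hw
  obtain ⟨s', h1, h2, h3, h4, h5⟩ := h.step (p := wid p) (w := 28 - wid p + 1) (d := 29) (by omega)
    (by omega) (by
      intro c h1 h2
      obtain ⟨i, rfl⟩ : ∃ i, c = wid p + i := ⟨c - wid p, by omega⟩
      rw [Fs_app, Fs_lo (by omega)]) (by
      intro c hc
      cases p with
      | nil => simp [wid] at hc
      | cons w0 d0 p0 =>
        rw [wid] at hc
        obtain rfl : c = wid p0 + w0 := by omega
        rw [app, Fs_app, Fs_lo le_rfl]
        exact hp) (by
      rw [Fs_app, ← Nat.add_zero (28 - wid p + 1), Fs_hi]; exact Nat.succ_pos _)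
  have h28 := h.le28 _ h4
  simp only at h28
  obtain ⟨s, rfl⟩ : ∃ s, s' = s + 1 := ⟨s' - 1, by omega⟩
  rw [show 29 - (s + 1) = 28 - s by omega] at h4 h5
  refine ⟨s, by omega, by omega, h4, ?_⟩
  rw [upd_app p (upd_tgt (w := 28 - wid p) (d := 29) (suf := nil) (s := s) (e := 28 - s) (by omega) (by omega))]
  exact h5

def top (R : Finset (ℕ × ℕ × ℕ)) : Finset (ℕ × ℕ × ℕ) := R.filter (fun q => q.2.1 + q.2.2 = 29)

lemma top_erase {R q} (hq : q ∈ R) (h : q.2.1 + q.2.2 = 29) : (top (R.erase q)).card + 1 = (top R).card := by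
  unfold top
  rw [Finset.filter_erase]
  exact Finset.card_erase_add_one (Finset.mem_filter.2 ⟨hq, h⟩)

lemma top_pos {F R c} (h : Fill F R) (hc : F c = 29) : 0 < (top R).card := by
  obtain ⟨q, hq, a1, a2, a3, a4⟩ := h.cov c 28 (by omega)
  have := h.inn q hq c a1 a2
  exact Finset.card_pos.2 ⟨q, Finset.mem_filter.2 ⟨hq, by omega⟩⟩

lemma Fs_app_lt {b} (p t) : (∀ i, Fs p i < b) → (∀ i, Fs t i < b) → ∀ i, Fs (app p t) i < b := by
  induction p generalizing t with
  | nil => intro _ h; exact h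
  | cons w d p ih =>
    intro h1 h2
    apply ih
    · intro i; have := h1 (w + 1 + i); rwa [Fs_hi] at this
    · intro i
      rw [Fs]
      split_ifs
      · have := h1 0; rwa [Fs_lo (by omega)] at this
      · exact h2 _

lemma top_zero {F R} (h : Fill F R) (hc : ∀ c, F c < 29) : (top R).card = 0 := by
  rw [Finset.card_eq_zero]
  apply Finset.eq_empty_of_forall_notMem
  intro q hq
  obtain ⟨hq, h1⟩ := Finset.mem_filter.1 hq
  have := h.pos q hq
  have := h.inn q hq q.1 le_rfl (by omega)
  have := hc q.1
  omega

lemma mcons_lt {b} (w d t) (hd : d < b) (ht : ∀ i, Fs t i < b) : ∀ i, Fs (mcons w d t) i < b := by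
  have : Fs (mcons w d t) = Fs (cons w d t) := by
    cases t with
    | nil => rfl
    | cons w' d' t =>
      rw [mcons_cons]; split_ifs with h
      · subst h; rw [Fs_merge]
      · rfl
  intro i
  rw [this, Fs]; split_ifs
  · exact hd
  · exact ht _

lemma rowc_sound {r D fst} (k) : ∀ p x R, rowc (chk r D) fst k p x = true → wid p = x → 1 ≤ x →
    x ≤ 28 → hd p < 29 → (∀ i, Fs p i < 29) → Fill (Fs (app p (cons (28 - x) 29 nil))) R →
    R.card ≤ r + k + 1 → (top R).card = k + 1 →
    (∀ q ∈ R, q.2.1 + q.2.2 = 29 → q.1 + q.2.2 = 29 → q.2.2 ≤ fst + 1) →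
    D + 1 ≤ ∑ q ∈ R, touch q → False := by
  induction k with
  | zero =>
    intro p x R hk hw h1 hx hp hlt hF hc ht hl hD
    obtain ⟨s, hs, hs', hq, hF'⟩ := row_step hw hx hp hF
    have hte := top_erase hq (by simp only; omega)
    have hce := Finset.card_erase_add_one hq
    have hsum := Finset.add_sum_erase R touch hq
    unfold tgt at hF'
    split_ifs at hF' with hss
    · subst hss
      have hlast := hl _ hq (by simp only; omega) (by simp only; omega)
      simp only at hlast
      rw [rowc_zero, Nat.ble_eq_true_of_le (by omega)] at hk
      simp only [Bool.not_true, Bool.false_or] at hk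
      have htou : touch (x, 28 - (28 - x), 28 - x + 1) = 1 := by
        unfold touch; simp only; split_ifs <;> omega
      refine chk_sound hk (by rw [wid_mcons]; omega) (by rw [Fs_mcons]; exact hF') (by omega) (by omega)
    · have := top_pos hF' (c := x + (s + 1)) (by
        rw [← hw, Fs_app, ← Nat.add_zero (s + 1), Fs_hi, Fs_lo (by omega)])
      omega
  | succ k ih =>
    intro p x R hk hw h1 hx hp hlt hF hc ht hl hD
    obtain ⟨s, hs, hs', hq, hF'⟩ := row_step hw hx hp hF
    have hte := top_erase hq (by simp only; omega)
    have hce := Finset.card_erase_add_one hq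
    have hsum := Finset.add_sum_erase R touch hq
    unfold tgt at hF'
    split_ifs at hF' with hss
    · have := top_zero hF' (Fs_app_lt _ _ hlt (by
        intro i; rw [Fs]; split_ifs
        · omega
        · exact Nat.succ_pos _))
      omega
    · have htou : touch (x, 28 - s, s + 1) = 0 := by
        unfold touch; simp only; split_ifs <;> omega
      refine ih (mcons s (28 - s) p) (x + s + 1) (R.erase (x, 28 - s, s + 1))
        ((rowc_succ _ _ _ _ _).1 hk s (by omega)) (by rw [wid_mcons]; omega) (by omega) (by omega)
        (by rw [hd_mcons]; omega) (mcons_lt _ _ _ (by omega) hlt) ?_ (by omega) (by omega)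
        (fun q hq => hl q (Finset.mem_of_mem_erase hq)) (by omega)
      rw [Fs_mcons]
      rwa [show 28 - (x + s + 1) = 28 - x - (s + 1) by omega]

lemma first_sound {r D k R} (hall : ∀ f < 28, rowc (chk r D) f k (cons f (28 - f) nil) (f + 1) = true)
    (hF : Fill (Fs (cons 28 29 nil)) R) (hc : R.card ≤ r + k + 2) (ht : (top R).card = k + 2)
    (hl : ∀ q ∈ R, ∀ q' ∈ R, q.2.1 + q.2.2 = 29 → q'.2.1 + q'.2.2 = 29 → q.1 = 0 →
      q'.1 + q'.2.2 = 29 → q'.2.2 ≤ q.2.2) (hD : D + 2 ≤ ∑ q ∈ R, touch q) : False := by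
  obtain ⟨s, hs, hs', hq, hF'⟩ := row_step (p := nil) (x := 0) rfl (by omega) (by rw [hd_nil]; omega) hF
  have hte := top_erase hq (by simp only; omega)
  have hce := Finset.card_erase_add_one hq
  have hsum := Finset.add_sum_erase R touch hq
  have htou : touch (0, 28 - s, s + 1) = 1 := by
    unfold touch; simp only; split_ifs <;> omega
  unfold tgt at hF'
  rw [if_neg (by omega)] at hF'
  refine rowc_sound k (cons s (28 - s) nil) (s + 1) (R.erase (0, 28 - s, s + 1)) (hall s hs') (by simp [wid])
    (by omega) (by omega) (by rw [hd_cons]; omega) ?_ ?_ (by omega) (by omega) ?_ (by omega)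
  · intro i; rw [Fs]; split_ifs
    · omega
    · exact Nat.succ_pos _
  · exact hF'
  · intro q hq' h1 h2
    exact hl _ hq q (Finset.mem_of_mem_erase hq') (by simp only; omega) h1 rfl h2

lemma rows_one {b r D f} (h : rows b r D f 1 = true) :
    rowc (chk r D) f b (cons f (28 - f) nil) (f + 1) = true := by
  have h' : (frc (f + 0) fun f => frc (28 - f) fun e =>
    rowc (chk r D) f b (cons f e nil) (f+1) && true) = true := h
  rw [frc_eq, frc_eq, Bool.and_true] at h'
  exact h'
structure Tl (R : Finset (ℕ × ℕ × ℕ)) : Prop where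
  bd : ∀ q ∈ R, 1 ≤ q.2.2 ∧ q.2.2 ≤ 28 ∧ q.1 + q.2.2 ≤ 29 ∧ q.2.1 + q.2.2 ≤ 29
  cov : ∀ i j, i < 29 → j < 29 → ∃ q ∈ R, Cov q i j
  unq : ∀ q ∈ R, ∀ q' ∈ R, ∀ i j, Cov q i j → Cov q' i j → q = q'

lemma Tl.fill {R} (h : Tl R) : Fill (Fs (cons 28 29 nil)) R := by
  refine ⟨fun q hq => (h.bd q hq).1, fun q hq => (h.bd q hq).2.1, ?_, ?_, h.unq⟩
  · intro q hq c h1 h2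
    have := h.bd q hq
    rw [Fs_lo (by omega)]; omega
  · intro i j hj
    by_cases hi : i ≤ 28
    · rw [Fs_lo hi] at hj; exact h.cov i j (by omega) hj
    · rw [Fs, if_neg hi] at hj; simp [Fs] at hj

def sw (q : ℕ × ℕ × ℕ) : ℕ × ℕ × ℕ := (q.2.1, q.1, q.2.2)
def rf (q : ℕ × ℕ × ℕ) : ℕ × ℕ × ℕ := (29 - (q.1 + q.2.2), q.2.1, q.2.2)

def cL (R : Finset (ℕ × ℕ × ℕ)) : ℕ := (R.filter (fun q => q.1 = 0)).card
def cR (R : Finset (ℕ × ℕ × ℕ)) : ℕ := (R.filter (fun q => q.1 + q.2.2 = 29)).card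
def cB (R : Finset (ℕ × ℕ × ℕ)) : ℕ := (R.filter (fun q => q.2.1 = 0)).card

lemma card_img {R : Finset (ℕ × ℕ × ℕ)} {g : ℕ × ℕ × ℕ → ℕ × ℕ × ℕ} (hg : Set.InjOn g R)
    {P Q : ℕ × ℕ × ℕ → Prop} [DecidablePred P] [DecidablePred Q] (hPQ : ∀ q ∈ R, P (g q) ↔ Q q) :
    ((R.image g).filter P).card = (R.filter Q).card := by
  rw [Finset.filter_image, Finset.card_image_of_injOn]
  · congr 1; exact Finset.filter_congr hPQ
  · exact hg.mono (fun q hq => (Finset.mem_filter.1 hq).1)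

lemma sw_inj (R : Finset (ℕ × ℕ × ℕ)) : Set.InjOn sw R := by
  rintro ⟨a, b, c⟩ _ ⟨a', b', c'⟩ _ h
  simp only [sw, Prod.mk.injEq] at h ⊢; omega
lemma Tl.rf_inj {R} (h : Tl R) : Set.InjOn rf R := by
  rintro ⟨a, b, c⟩ h1 ⟨a', b', c'⟩ h2 he
  have := h.bd _ h1
  have := h.bd _ h2
  simp only [rf, Prod.mk.injEq] at *; omega

lemma Tl.sw {R} (h : Tl R) : Tl (R.image sw) := by
  refine ⟨?_, ?_, ?_⟩
  · intro q hq
    obtain ⟨a, ha, rfl⟩ := Finset.mem_image.1 hq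
    have := h.bd a ha
    simp only [Sky.sw]; omega
  · intro i j hi hj
    obtain ⟨q, hq, h1, h2, h3, h4⟩ := h.cov j i hj hi
    exact ⟨Sky.sw q, Finset.mem_image_of_mem _ hq, h3, h4, h1, h2⟩
  · intro q hq q' hq' i j hc hc'
    obtain ⟨a, ha, rfl⟩ := Finset.mem_image.1 hq
    obtain ⟨a', ha', rfl⟩ := Finset.mem_image.1 hq'
    obtain ⟨h1, h2, h3, h4⟩ := hc
    obtain ⟨g1, g2, g3, g4⟩ := hc'
    rw [h.unq a ha a' ha' j i ⟨h3, h4, h1, h2⟩ ⟨g3, g4, g1, g2⟩]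

lemma Tl.rf {R} (h : Tl R) : Tl (R.image rf) := by
  refine ⟨?_, ?_, ?_⟩
  · intro q hq
    obtain ⟨a, ha, rfl⟩ := Finset.mem_image.1 hq
    have := h.bd a ha
    simp only [Sky.rf]; omega
  · intro i j hi hj
    obtain ⟨q, hq, h1, h2, h3, h4⟩ := h.cov (28 - i) j (by omega) hj
    have := h.bd q hq
    refine ⟨Sky.rf q, Finset.mem_image_of_mem _ hq, ?_, ?_, ?_, ?_⟩ <;> simp only [Sky.rf] <;> omega
  · intro q hq q' hq' i j hc hc'
    obtain ⟨a, ha, rfl⟩ := Finset.mem_image.1 hq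
    obtain ⟨a', ha', rfl⟩ := Finset.mem_image.1 hq'
    have := h.bd a ha
    have := h.bd a' ha'
    obtain ⟨h1, h2, h3, h4⟩ := hc
    obtain ⟨g1, g2, g3, g4⟩ := hc'
    simp only [Sky.rf] at *
    rw [h.unq a ha a' ha' (28 - i) j ⟨by omega, by omega, by omega, by omega⟩
      ⟨by omega, by omega, by omega, by omega⟩]

lemma Tl.sw_c {R} (_h : Tl R) : (R.image Sky.sw).card = R.card ∧ (top (R.image Sky.sw)).card = cR R ∧
    cR (R.image Sky.sw) = (top R).card ∧ cL (R.image Sky.sw) = cB R ∧ cB (R.image Sky.sw) = cL R := by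
  refine ⟨Finset.card_image_of_injOn (sw_inj R), card_img (sw_inj R) ?_, card_img (sw_inj R) ?_,
    card_img (sw_inj R) ?_, card_img (sw_inj R) ?_⟩ <;> intro q _ <;> rfl

lemma Tl.rf_c {R} (h : Tl R) : (R.image Sky.rf).card = R.card ∧
    (top (R.image Sky.rf)).card = (top R).card ∧
    cR (R.image Sky.rf) = cL R ∧ cL (R.image Sky.rf) = cR R ∧ cB (R.image Sky.rf) = cB R := by
  refine ⟨Finset.card_image_of_injOn h.rf_inj, card_img h.rf_inj ?_, card_img h.rf_inj ?_,
    card_img h.rf_inj ?_, card_img h.rf_inj ?_⟩ <;> intro q hq <;> have := h.bd q hq <;>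
    simp only [Sky.rf] <;> omega

lemma sum_touch (R : Finset (ℕ × ℕ × ℕ)) : ∑ q ∈ R, touch q = cL R + cR R + cB R := by
  unfold touch cL cR cB
  rw [Finset.sum_add_distrib, Finset.sum_add_distrib, Finset.card_filter, Finset.card_filter,
    Finset.card_filter]

lemma Tl.corner {R} (h : Tl R) {P : ℕ × ℕ × ℕ → Prop} [DecidablePred P] (i j : ℕ)
    (hP : ∀ q ∈ R, P q → Cov q i j) : (R.filter P).card ≤ 1 := by
  rw [Finset.card_le_one]
  intro a ha b hb
  obtain ⟨ha, hPa⟩ := Finset.mem_filter.1 ha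
  obtain ⟨hb, hPb⟩ := Finset.mem_filter.1 hb
  exact h.unq a ha b hb i j (hP a ha hPa) (hP b hb hPb)

lemma Tl.four {R} (h : Tl R) : cL R + cR R + cB R + (top R).card ≤ R.card + 4 := by
  have hA := h.corner (P := fun q => q.1 = 0 ∧ q.2.1 = 0) 0 0 (by
    intro q hq hP; have := h.bd q hq; exact ⟨by omega, by omega, by omega, by omega⟩)
  have hB := h.corner (P := fun q => q.1 + q.2.2 = 29 ∧ q.2.1 = 0) 28 0 (by
    intro q hq hP; have := h.bd q hq; exact ⟨by omega, by omega, by omega, by omega⟩)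
  have hC := h.corner (P := fun q => q.1 = 0 ∧ q.2.1 + q.2.2 = 29) 0 28 (by
    intro q hq hP; have := h.bd q hq; exact ⟨by omega, by omega, by omega, by omega⟩)
  have hD := h.corner (P := fun q => q.1 + q.2.2 = 29 ∧ q.2.1 + q.2.2 = 29) 28 28 (by
    intro q hq hP; have := h.bd q hq; exact ⟨by omega, by omega, by omega, by omega⟩)
  have hle : ∑ q ∈ R, (touch q + if q.2.1 + q.2.2 = 29 then 1 else 0) ≤
      ∑ q ∈ R, (1 + (if q.1 = 0 ∧ q.2.1 = 0 then 1 else 0)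
      + (if q.1 + q.2.2 = 29 ∧ q.2.1 = 0 then 1 else 0)
      + (if q.1 = 0 ∧ q.2.1 + q.2.2 = 29 then 1 else 0)
      + (if q.1 + q.2.2 = 29 ∧ q.2.1 + q.2.2 = 29 then 1 else 0)) := by
    apply Finset.sum_le_sum
    intro q hq
    have h1 := h.bd q hq
    unfold touch
    split_ifs <;> omega
  simp only [Finset.sum_add_distrib, ← Finset.card_filter] at hle
  rw [sum_touch] at hle
  simp only [Finset.sum_const, smul_eq_mul, mul_one] at hle
  unfold top
  omega

lemma Tl.two {R} (h : Tl R) : 2 ≤ (top R).card := by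
  obtain ⟨q, hq, a1, a2, a3, a4⟩ := h.cov 0 28 (by omega) (by omega)
  obtain ⟨q', hq', b1, b2, b3, b4⟩ := h.cov 28 28 (by omega) (by omega)
  have h1 := h.bd q hq
  have h2 := h.bd q' hq'
  apply Finset.one_lt_card.2
  refine ⟨q, Finset.mem_filter.2 ⟨hq, by omega⟩, q', Finset.mem_filter.2 ⟨hq', by omega⟩, ?_⟩
  rintro rfl; omega

def All (k r D : ℕ) : Prop :=
  ∀ f < 28, rowc (chk r D) f k (cons f (28 - f) nil) (f + 1) = true

lemma core1 (h2 : All 0 11 4) (h3 : All 1 10 7) (h4 : All 2 9 10) {R} (h : Tl R) (hc : R.card ≤ 13)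
    (hL : (top R).card ≤ cL R) (hR : (top R).card ≤ cR R) (hB : (top R).card ≤ cB R)
    (hl : ∀ q ∈ R, ∀ q' ∈ R, q.2.1 + q.2.2 = 29 → q'.2.1 + q'.2.2 = 29 → q.1 = 0 →
      q'.1 + q'.2.2 = 29 → q'.2.2 ≤ q.2.2) : False := by
  have t2 := h.two
  have t4 := h.four
  have hs := sum_touch R
  have hcase : (top R).card = 2 ∨ (top R).card = 3 ∨ (top R).card = 4 := by omega
  rcases hcase with ht | ht | ht
  · exact first_sound h2 h.fill (by omega) (by omega) hl (by omega)
  · exact first_sound h3 h.fill (by omega) (by omega) hl (by omega)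
  · exact first_sound h4 h.fill (by omega) (by omega) hl (by omega)

lemma core2 (h2 : All 0 11 4) (h3 : All 1 10 7) (h4 : All 2 9 10) {R} (h : Tl R) (hc : R.card ≤ 13)
    (hL : (top R).card ≤ cL R) (hR : (top R).card ≤ cR R) (hB : (top R).card ≤ cB R) : False := by
  by_cases hl : ∀ q ∈ R, ∀ q' ∈ R, q.2.1 + q.2.2 = 29 → q'.2.1 + q'.2.2 = 29 → q.1 = 0 →
      q'.1 + q'.2.2 = 29 → q'.2.2 ≤ q.2.2
  · exact core1 h2 h3 h4 h hc hL hR hB hl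
  · push Not at hl
    obtain ⟨q, hq, q', hq', e1, e2, e3, e4, e5⟩ := hl
    obtain ⟨c1, c2, c3, c4, c5⟩ := h.rf_c
    refine core1 h2 h3 h4 h.rf (by omega) (by omega) (by omega) (by omega) ?_
    intro a ha a' ha' g1 g2 g3 g4
    obtain ⟨b, hb, rfl⟩ := Finset.mem_image.1 ha
    obtain ⟨b', hb', rfl⟩ := Finset.mem_image.1 ha'
    have d1 := h.bd b hb
    have d2 := h.bd b' hb'
    have d3 := h.bd q hq
    have d4 := h.bd q' hq'
    simp only [rf] at g1 g2 g3 g4 ⊢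
    have : b = q' := h.unq b hb q' hq' 28 28 ⟨by omega, by omega, by omega, by omega⟩
      ⟨by omega, by omega, by omega, by omega⟩
    have : b' = q := h.unq b' hb' q hq 0 28 ⟨by omega, by omega, by omega, by omega⟩
      ⟨by omega, by omega, by omega, by omega⟩
    subst_vars
    omega

lemma core3 (h2 : All 0 11 4) (h3 : All 1 10 7) (h4 : All 2 9 10) {R} (h : Tl R)
    (hc : R.card ≤ 13) : False := by
  obtain ⟨a1, a2, a3, a4, a5⟩ := h.sw_c
  obtain ⟨b1, b2, b3, b4, b5⟩ := h.rf_c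
  obtain ⟨c1, c2, c3, c4, c5⟩ := h.rf.sw_c
  obtain ⟨d1, d2, d3, d4, d5⟩ := h.sw.rf_c
  obtain ⟨e1, e2, e3, e4, e5⟩ := h.sw.rf.sw_c
  have hcase : ((top R).card ≤ cL R ∧ (top R).card ≤ cR R ∧ (top R).card ≤ cB R) ∨
    (cR R ≤ (top R).card ∧ cR R ≤ cL R ∧ cR R ≤ cB R) ∨
    (cL R ≤ (top R).card ∧ cL R ≤ cR R ∧ cL R ≤ cB R) ∨
    (cB R ≤ (top R).card ∧ cB R ≤ cR R ∧ cB R ≤ cL R) := by omega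
  rcases hcase with ⟨g1, g2, g3⟩ | ⟨g1, g2, g3⟩ | ⟨g1, g2, g3⟩ | ⟨g1, g2, g3⟩
  · exact core2 h2 h3 h4 h hc g1 g2 g3
  · exact core2 h2 h3 h4 h.sw (by omega) (by omega) (by omega) (by omega)
  · exact core2 h2 h3 h4 h.rf.sw (by omega) (by omega) (by omega) (by omega)
  · exact core2 h2 h3 h4 h.sw.rf.sw (by omega) (by omega) (by omega) (by omega)

lemma tl_of {R} (h : IsSquaredTiling 29 R) : Tl R := by
  refine ⟨fun q hq => by have := h.1 q hq; omega, ?_, ?_⟩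
  · intro i j hi hj
    obtain ⟨q, ⟨hq, hc⟩, _⟩ := h.2 i j hi hj
    exact ⟨q, hq, hc⟩
  · intro q hq q' hq' i j hc hc'
    have := h.1 q hq
    have hi : i < 29 := by have := hc.2.1; omega
    have hj : j < 29 := by have := hc.2.2.2; omega
    exact (h.2 i j hi hj).unique ⟨hq, hc⟩ ⟨hq', hc'⟩

def exT : Finset (ℕ × ℕ × ℕ) := {(0,0,17), (17,0,12), (17,12,4), (21,12,8), (17,16,2), (19,16,2),
  (0,17,12), (12,17,4), (16,17,1), (16,18,3), (19,18,2), (19,20,1), (20,20,9), (12,21,8)}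

lemma exT_tiling : IsSquaredTiling 29 exT := by
  have key : ∀ i < 29, ∀ j < 29, (exT.filter (fun t => t.1 ≤ i ∧ i < t.1 + t.2.2 ∧ t.2.1 ≤ j ∧
      j < t.2.1 + t.2.2)).card = 1 := by decide +kernel
  refine ⟨by decide +kernel, ?_⟩
  intro i j hi hj
  obtain ⟨t, ht⟩ := Finset.card_eq_one.1 (key i hi j hj)
  refine ⟨t, ?_, ?_⟩
  · have : t ∈ exT.filter (fun t => t.1 ≤ i ∧ i < t.1 + t.2.2 ∧ t.2.1 ≤ j ∧ j < t.2.1 + t.2.2) := by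
      rw [ht]; exact Finset.mem_singleton_self t
    exact Finset.mem_filter.1 this
  · intro u hu
    have : u ∈ exT.filter (fun t => t.1 ≤ i ∧ i < t.1 + t.2.2 ∧ t.2.1 ≤ j ∧ j < t.2.1 + t.2.2) :=
      Finset.mem_filter.2 hu
    rw [ht] at this
    exact Finset.mem_singleton.1 this

lemma final (h2 : All 0 11 4) (h3 : All 1 10 7) (h4 : All 2 9 10) : s 29 = 14 := by
  unfold s
  have hmem : 14 ∈ {k | ∃ T : Finset (ℕ × ℕ × ℕ), IsSquaredTiling 29 T ∧ T.card = k} :=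
    ⟨exT, exT_tiling, by decide +kernel⟩
  apply le_antisymm (Nat.sInf_le hmem)
  obtain ⟨T, hT, hc⟩ := Nat.sInf_mem ⟨_, hmem⟩
  rw [← hc]
  by_contra hlt
  exact core3 h2 h3 h4 (tl_of hT) (by omega)

noncomputable def sec (f lo n : ℕ) : Bool :=
  Nat.rec true (fun i ih => frc (lo+i) fun s => frc (28-s) fun e => frc (f+1+s+1) fun x =>
    frc (28-f) fun e1 => rowc (chk 10 7) f 0 (mcons s e (cons f e1 nil)) x && ih) n

lemma sec_sound {f lo} (n) (h : sec f lo n = true) : ∀ s, lo ≤ s → s < lo + n →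
    rowc (chk 10 7) f 0 (mcons s (28 - s) (cons f (28 - f) nil)) (f + 1 + s + 1) = true := by
  induction n with
  | zero => intro s h1 h2; omega
  | succ n ih =>
    have h' : (frc (lo+n) fun s => frc (28-s) fun e => frc (f+1+s+1) fun x =>
      frc (28-f) fun e1 => rowc (chk 10 7) f 0 (mcons s e (cons f e1 nil)) x && sec f lo n) = true := h
    simp only [frc_eq, Bool.and_eq_true] at h'
    intro s h1 h2
    rcases Nat.lt_or_ge s (lo + n) with h3 | h3
    · exact ih h'.2 s h1 h3
    · obtain rfl : s = lo + n := by omega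
      exact h'.1

lemma rows_sound {b r D lo} (n) (h : rows b r D lo n = true) : ∀ f, lo ≤ f → f < lo + n →
    rowc (chk r D) f b (cons f (28 - f) nil) (f + 1) = true := by
  induction n with
  | zero => intro s h1 h2; omega
  | succ n ih =>
    have h' : (frc (lo+n) fun f => frc (28-f) fun e =>
      rowc (chk r D) f b (cons f e nil) (f+1) && rows b r D lo n) = true := h
    simp only [frc_eq, Bool.and_eq_true] at h'
    intro s h1 h2
    rcases Nat.lt_or_ge s (lo + n) with h3 | h3
    · exact ih h'.2 s h1 h3
    · obtain rfl : s = lo + n := by omega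
      exact h'.1

lemma a2_0 : rows 0 11 4 0 12 = true := by decide +kernel
lemma a2_12 : rows 0 11 4 12 1 = true := by decide +kernel
lemma a2_13 : rows 0 11 4 13 1 = true := by decide +kernel
lemma a2_14 : rows 0 11 4 14 1 = true := by decide +kernel
lemma a2_15 : rows 0 11 4 15 1 = true := by decide +kernel
lemma a2_16 : rows 0 11 4 16 1 = true := by decide +kernel
lemma a2_17 : rows 0 11 4 17 1 = true := by decide +kernel
lemma a2_18 : rows 0 11 4 18 1 = true := by decide +kernel
lemma a2_19 : rows 0 11 4 19 1 = true := by decide +kernel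
lemma a2_20 : rows 0 11 4 20 1 = true := by decide +kernel
lemma a2_21 : rows 0 11 4 21 1 = true := by decide +kernel
lemma a2_22 : rows 0 11 4 22 6 = true := by decide +kernel
lemma a2 : All 0 11 4 := by
  intro f hf
  rcases Nat.lt_or_ge f 12 with h0 | h0
  · exact rows_sound _ a2_0 f (by omega) (by omega)
  rcases Nat.lt_or_ge f 13 with h12 | h12
  · exact rows_sound _ a2_12 f (by omega) (by omega)
  rcases Nat.lt_or_ge f 14 with h13 | h13
  · exact rows_sound _ a2_13 f (by omega) (by omega)
  rcases Nat.lt_or_ge f 15 with h14 | h14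
  · exact rows_sound _ a2_14 f (by omega) (by omega)
  rcases Nat.lt_or_ge f 16 with h15 | h15
  · exact rows_sound _ a2_15 f (by omega) (by omega)
  rcases Nat.lt_or_ge f 17 with h16 | h16
  · exact rows_sound _ a2_16 f (by omega) (by omega)
  rcases Nat.lt_or_ge f 18 with h17 | h17
  · exact rows_sound _ a2_17 f (by omega) (by omega)
  rcases Nat.lt_or_ge f 19 with h18 | h18
  · exact rows_sound _ a2_18 f (by omega) (by omega)
  rcases Nat.lt_or_ge f 20 with h19 | h19
  · exact rows_sound _ a2_19 f (by omega) (by omega)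
  rcases Nat.lt_or_ge f 21 with h20 | h20
  · exact rows_sound _ a2_20 f (by omega) (by omega)
  rcases Nat.lt_or_ge f 22 with h21 | h21
  · exact rows_sound _ a2_21 f (by omega) (by omega)
  exact rows_sound _ a2_22 f (by omega) (by omega)
lemma a4_0 : rows 2 9 10 0 5 = true := by decide +kernel
lemma a4_5 : rows 2 9 10 5 1 = true := by decide +kernel
lemma a4_6 : rows 2 9 10 6 1 = true := by decide +kernel
lemma a4_7 : rows 2 9 10 7 1 = true := by decide +kernel
lemma a4_8 : rows 2 9 10 8 1 = true := by decide +kernel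
lemma a4_9 : rows 2 9 10 9 1 = true := by decide +kernel
lemma a4_10 : rows 2 9 10 10 1 = true := by decide +kernel
lemma a4_11 : rows 2 9 10 11 1 = true := by decide +kernel
lemma a4_12 : rows 2 9 10 12 1 = true := by decide +kernel
lemma a4_13 : rows 2 9 10 13 1 = true := by decide +kernel
lemma a4_14 : rows 2 9 10 14 1 = true := by decide +kernel
lemma a4_15 : rows 2 9 10 15 1 = true := by decide +kernel
lemma a4_16 : rows 2 9 10 16 12 = true := by decide +kernel
lemma a4 : All 2 9 10 := by
  intro f hf
  rcases Nat.lt_or_ge f 5 with h0 | h0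
  · exact rows_sound _ a4_0 f (by omega) (by omega)
  rcases Nat.lt_or_ge f 6 with h5 | h5
  · exact rows_sound _ a4_5 f (by omega) (by omega)
  rcases Nat.lt_or_ge f 7 with h6 | h6
  · exact rows_sound _ a4_6 f (by omega) (by omega)
  rcases Nat.lt_or_ge f 8 with h7 | h7
  · exact rows_sound _ a4_7 f (by omega) (by omega)
  rcases Nat.lt_or_ge f 9 with h8 | h8
  · exact rows_sound _ a4_8 f (by omega) (by omega)
  rcases Nat.lt_or_ge f 10 with h9 | h9
  · exact rows_sound _ a4_9 f (by omega) (by omega)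
  rcases Nat.lt_or_ge f 11 with h10 | h10
  · exact rows_sound _ a4_10 f (by omega) (by omega)
  rcases Nat.lt_or_ge f 12 with h11 | h11
  · exact rows_sound _ a4_11 f (by omega) (by omega)
  rcases Nat.lt_or_ge f 13 with h12 | h12
  · exact rows_sound _ a4_12 f (by omega) (by omega)
  rcases Nat.lt_or_ge f 14 with h13 | h13
  · exact rows_sound _ a4_13 f (by omega) (by omega)
  rcases Nat.lt_or_ge f 15 with h14 | h14
  · exact rows_sound _ a4_14 f (by omega) (by omega)
  rcases Nat.lt_or_ge f 16 with h15 | h15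
  · exact rows_sound _ a4_15 f (by omega) (by omega)
  exact rows_sound _ a4_16 f (by omega) (by omega)
lemma a3_0 : rows 1 10 7 0 6 = true := by decide +kernel
lemma a3_6 : rows 1 10 7 6 1 = true := by decide +kernel
lemma a3_7 : rows 1 10 7 7 1 = true := by decide +kernel
lemma a3_15 : rows 1 10 7 15 1 = true := by decide +kernel
lemma a3_16 : rows 1 10 7 16 1 = true := by decide +kernel
lemma a3_17 : rows 1 10 7 17 1 = true := by decide +kernel
lemma a3_18 : rows 1 10 7 18 1 = true := by decide +kernel
lemma a3_19 : rows 1 10 7 19 1 = true := by decide +kernel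
lemma a3_20 : rows 1 10 7 20 8 = true := by decide +kernel
lemma a3h_8_0 : sec 8 0 2 = true := by decide +kernel
lemma a3h_8_2 : sec 8 2 2 = true := by decide +kernel
lemma a3h_8_4 : sec 8 4 2 = true := by decide +kernel
lemma a3h_8_6 : sec 8 6 2 = true := by decide +kernel
lemma a3h_8_8 : sec 8 8 2 = true := by decide +kernel
lemma a3h_8_10 : sec 8 10 2 = true := by decide +kernel
lemma a3h_8_12 : sec 8 12 2 = true := by decide +kernel
lemma a3h_8_14 : sec 8 14 2 = true := by decide +kernel
lemma a3h_8_16 : sec 8 16 2 = true := by decide +kernel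
lemma a3h_8_18 : sec 8 18 1 = true := by decide +kernel
lemma a3h_8 : rowc (chk 10 7) 8 1 (cons 8 (28 - 8) nil) (8 + 1) = true := by
  rw [rowc_succ]
  intro s hs
  rcases Nat.lt_or_ge s 2 with h0 | h0
  · exact sec_sound _ a3h_8_0 s (by omega) (by omega)
  rcases Nat.lt_or_ge s 4 with h2 | h2
  · exact sec_sound _ a3h_8_2 s (by omega) (by omega)
  rcases Nat.lt_or_ge s 6 with h4 | h4
  · exact sec_sound _ a3h_8_4 s (by omega) (by omega)
  rcases Nat.lt_or_ge s 8 with h6 | h6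
  · exact sec_sound _ a3h_8_6 s (by omega) (by omega)
  rcases Nat.lt_or_ge s 10 with h8 | h8
  · exact sec_sound _ a3h_8_8 s (by omega) (by omega)
  rcases Nat.lt_or_ge s 12 with h10 | h10
  · exact sec_sound _ a3h_8_10 s (by omega) (by omega)
  rcases Nat.lt_or_ge s 14 with h12 | h12
  · exact sec_sound _ a3h_8_12 s (by omega) (by omega)
  rcases Nat.lt_or_ge s 16 with h14 | h14
  · exact sec_sound _ a3h_8_14 s (by omega) (by omega)
  rcases Nat.lt_or_ge s 18 with h16 | h16
  · exact sec_sound _ a3h_8_16 s (by omega) (by omega)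
  exact sec_sound _ a3h_8_18 s (by omega) (by omega)
lemma a3h_9_0 : sec 9 0 2 = true := by decide +kernel
lemma a3h_9_2 : sec 9 2 2 = true := by decide +kernel
lemma a3h_9_4 : sec 9 4 2 = true := by decide +kernel
lemma a3h_9_6 : sec 9 6 2 = true := by decide +kernel
lemma a3h_9_8 : sec 9 8 2 = true := by decide +kernel
lemma a3h_9_10 : sec 9 10 2 = true := by decide +kernel
lemma a3h_9_12 : sec 9 12 2 = true := by decide +kernel
lemma a3h_9_14 : sec 9 14 2 = true := by decide +kernel
lemma a3h_9_16 : sec 9 16 2 = true := by decide +kernel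
lemma a3h_9 : rowc (chk 10 7) 9 1 (cons 9 (28 - 9) nil) (9 + 1) = true := by
  rw [rowc_succ]
  intro s hs
  rcases Nat.lt_or_ge s 2 with h0 | h0
  · exact sec_sound _ a3h_9_0 s (by omega) (by omega)
  rcases Nat.lt_or_ge s 4 with h2 | h2
  · exact sec_sound _ a3h_9_2 s (by omega) (by omega)
  rcases Nat.lt_or_ge s 6 with h4 | h4
  · exact sec_sound _ a3h_9_4 s (by omega) (by omega)
  rcases Nat.lt_or_ge s 8 with h6 | h6
  · exact sec_sound _ a3h_9_6 s (by omega) (by omega)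
  rcases Nat.lt_or_ge s 10 with h8 | h8
  · exact sec_sound _ a3h_9_8 s (by omega) (by omega)
  rcases Nat.lt_or_ge s 12 with h10 | h10
  · exact sec_sound _ a3h_9_10 s (by omega) (by omega)
  rcases Nat.lt_or_ge s 14 with h12 | h12
  · exact sec_sound _ a3h_9_12 s (by omega) (by omega)
  rcases Nat.lt_or_ge s 16 with h14 | h14
  · exact sec_sound _ a3h_9_14 s (by omega) (by omega)
  exact sec_sound _ a3h_9_16 s (by omega) (by omega)
lemma a3h_10_0 : sec 10 0 2 = true := by decide +kernel
lemma a3h_10_2 : sec 10 2 2 = true := by decide +kernel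
lemma a3h_10_4 : sec 10 4 2 = true := by decide +kernel
lemma a3h_10_6 : sec 10 6 2 = true := by decide +kernel
lemma a3h_10_8 : sec 10 8 2 = true := by decide +kernel
lemma a3h_10_10 : sec 10 10 2 = true := by decide +kernel
lemma a3h_10_12 : sec 10 12 2 = true := by decide +kernel
lemma a3h_10_14 : sec 10 14 2 = true := by decide +kernel
lemma a3h_10_16 : sec 10 16 1 = true := by decide +kernel
lemma a3h_10 : rowc (chk 10 7) 10 1 (cons 10 (28 - 10) nil) (10 + 1) = true := by
  rw [rowc_succ]
  intro s hs
  rcases Nat.lt_or_ge s 2 with h0 | h0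
  · exact sec_sound _ a3h_10_0 s (by omega) (by omega)
  rcases Nat.lt_or_ge s 4 with h2 | h2
  · exact sec_sound _ a3h_10_2 s (by omega) (by omega)
  rcases Nat.lt_or_ge s 6 with h4 | h4
  · exact sec_sound _ a3h_10_4 s (by omega) (by omega)
  rcases Nat.lt_or_ge s 8 with h6 | h6
  · exact sec_sound _ a3h_10_6 s (by omega) (by omega)
  rcases Nat.lt_or_ge s 10 with h8 | h8
  · exact sec_sound _ a3h_10_8 s (by omega) (by omega)
  rcases Nat.lt_or_ge s 12 with h10 | h10
  · exact sec_sound _ a3h_10_10 s (by omega) (by omega)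
  rcases Nat.lt_or_ge s 14 with h12 | h12
  · exact sec_sound _ a3h_10_12 s (by omega) (by omega)
  rcases Nat.lt_or_ge s 16 with h14 | h14
  · exact sec_sound _ a3h_10_14 s (by omega) (by omega)
  exact sec_sound _ a3h_10_16 s (by omega) (by omega)
lemma a3h_11_0 : sec 11 0 2 = true := by decide +kernel
lemma a3h_11_2 : sec 11 2 2 = true := by decide +kernel
lemma a3h_11_4 : sec 11 4 2 = true := by decide +kernel
lemma a3h_11_6 : sec 11 6 2 = true := by decide +kernel
lemma a3h_11_8 : sec 11 8 2 = true := by decide +kernel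
lemma a3h_11_10 : sec 11 10 2 = true := by decide +kernel
lemma a3h_11_12 : sec 11 12 2 = true := by decide +kernel
lemma a3h_11_14 : sec 11 14 2 = true := by decide +kernel
lemma a3h_11 : rowc (chk 10 7) 11 1 (cons 11 (28 - 11) nil) (11 + 1) = true := by
  rw [rowc_succ]
  intro s hs
  rcases Nat.lt_or_ge s 2 with h0 | h0
  · exact sec_sound _ a3h_11_0 s (by omega) (by omega)
  rcases Nat.lt_or_ge s 4 with h2 | h2
  · exact sec_sound _ a3h_11_2 s (by omega) (by omega)
  rcases Nat.lt_or_ge s 6 with h4 | h4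
  · exact sec_sound _ a3h_11_4 s (by omega) (by omega)
  rcases Nat.lt_or_ge s 8 with h6 | h6
  · exact sec_sound _ a3h_11_6 s (by omega) (by omega)
  rcases Nat.lt_or_ge s 10 with h8 | h8
  · exact sec_sound _ a3h_11_8 s (by omega) (by omega)
  rcases Nat.lt_or_ge s 12 with h10 | h10
  · exact sec_sound _ a3h_11_10 s (by omega) (by omega)
  rcases Nat.lt_or_ge s 14 with h12 | h12
  · exact sec_sound _ a3h_11_12 s (by omega) (by omega)
  exact sec_sound _ a3h_11_14 s (by omega) (by omega)
lemma a3h_12_0 : sec 12 0 2 = true := by decide +kernel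
lemma a3h_12_2 : sec 12 2 2 = true := by decide +kernel
lemma a3h_12_4 : sec 12 4 2 = true := by decide +kernel
lemma a3h_12_6 : sec 12 6 2 = true := by decide +kernel
lemma a3h_12_8 : sec 12 8 2 = true := by decide +kernel
lemma a3h_12_10 : sec 12 10 2 = true := by decide +kernel
lemma a3h_12_12 : sec 12 12 2 = true := by decide +kernel
lemma a3h_12_14 : sec 12 14 1 = true := by decide +kernel
lemma a3h_12 : rowc (chk 10 7) 12 1 (cons 12 (28 - 12) nil) (12 + 1) = true := by
  rw [rowc_succ]
  intro s hs
  rcases Nat.lt_or_ge s 2 with h0 | h0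
  · exact sec_sound _ a3h_12_0 s (by omega) (by omega)
  rcases Nat.lt_or_ge s 4 with h2 | h2
  · exact sec_sound _ a3h_12_2 s (by omega) (by omega)
  rcases Nat.lt_or_ge s 6 with h4 | h4
  · exact sec_sound _ a3h_12_4 s (by omega) (by omega)
  rcases Nat.lt_or_ge s 8 with h6 | h6
  · exact sec_sound _ a3h_12_6 s (by omega) (by omega)
  rcases Nat.lt_or_ge s 10 with h8 | h8
  · exact sec_sound _ a3h_12_8 s (by omega) (by omega)
  rcases Nat.lt_or_ge s 12 with h10 | h10
  · exact sec_sound _ a3h_12_10 s (by omega) (by omega)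
  rcases Nat.lt_or_ge s 14 with h12 | h12
  · exact sec_sound _ a3h_12_12 s (by omega) (by omega)
  exact sec_sound _ a3h_12_14 s (by omega) (by omega)
lemma a3h_13_0 : sec 13 0 2 = true := by decide +kernel
lemma a3h_13_2 : sec 13 2 2 = true := by decide +kernel
lemma a3h_13_4 : sec 13 4 2 = true := by decide +kernel
lemma a3h_13_6 : sec 13 6 2 = true := by decide +kernel
lemma a3h_13_8 : sec 13 8 2 = true := by decide +kernel
lemma a3h_13_10 : sec 13 10 2 = true := by decide +kernel
lemma a3h_13_12 : sec 13 12 2 = true := by decide +kernel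
lemma a3h_13 : rowc (chk 10 7) 13 1 (cons 13 (28 - 13) nil) (13 + 1) = true := by
  rw [rowc_succ]
  intro s hs
  rcases Nat.lt_or_ge s 2 with h0 | h0
  · exact sec_sound _ a3h_13_0 s (by omega) (by omega)
  rcases Nat.lt_or_ge s 4 with h2 | h2
  · exact sec_sound _ a3h_13_2 s (by omega) (by omega)
  rcases Nat.lt_or_ge s 6 with h4 | h4
  · exact sec_sound _ a3h_13_4 s (by omega) (by omega)
  rcases Nat.lt_or_ge s 8 with h6 | h6
  · exact sec_sound _ a3h_13_6 s (by omega) (by omega)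
  rcases Nat.lt_or_ge s 10 with h8 | h8
  · exact sec_sound _ a3h_13_8 s (by omega) (by omega)
  rcases Nat.lt_or_ge s 12 with h10 | h10
  · exact sec_sound _ a3h_13_10 s (by omega) (by omega)
  exact sec_sound _ a3h_13_12 s (by omega) (by omega)
lemma a3h_14_0 : sec 14 0 2 = true := by decide +kernel
lemma a3h_14_2 : sec 14 2 2 = true := by decide +kernel
lemma a3h_14_4 : sec 14 4 2 = true := by decide +kernel
lemma a3h_14_6 : sec 14 6 2 = true := by decide +kernel
lemma a3h_14_8 : sec 14 8 2 = true := by decide +kernel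
lemma a3h_14_10 : sec 14 10 2 = true := by decide +kernel
lemma a3h_14_12 : sec 14 12 1 = true := by decide +kernel
lemma a3h_14 : rowc (chk 10 7) 14 1 (cons 14 (28 - 14) nil) (14 + 1) = true := by
  rw [rowc_succ]
  intro s hs
  rcases Nat.lt_or_ge s 2 with h0 | h0
  · exact sec_sound _ a3h_14_0 s (by omega) (by omega)
  rcases Nat.lt_or_ge s 4 with h2 | h2
  · exact sec_sound _ a3h_14_2 s (by omega) (by omega)
  rcases Nat.lt_or_ge s 6 with h4 | h4
  · exact sec_sound _ a3h_14_4 s (by omega) (by omega)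
  rcases Nat.lt_or_ge s 8 with h6 | h6
  · exact sec_sound _ a3h_14_6 s (by omega) (by omega)
  rcases Nat.lt_or_ge s 10 with h8 | h8
  · exact sec_sound _ a3h_14_8 s (by omega) (by omega)
  rcases Nat.lt_or_ge s 12 with h10 | h10
  · exact sec_sound _ a3h_14_10 s (by omega) (by omega)
  exact sec_sound _ a3h_14_12 s (by omega) (by omega)
lemma a3 : All 1 10 7 := by
  intro f hf
  rcases Nat.lt_or_ge f 6 with h0 | h0
  · exact rows_sound _ a3_0 f (by omega) (by omega)
  rcases Nat.lt_or_ge f 7 with h6 | h6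
  · exact rows_sound _ a3_6 f (by omega) (by omega)
  rcases Nat.lt_or_ge f 8 with h7 | h7
  · exact rows_sound _ a3_7 f (by omega) (by omega)
  rcases Nat.lt_or_ge f 9 with h8 | h8
  · obtain rfl : f = 8 := by omega
    exact a3h_8
  rcases Nat.lt_or_ge f 10 with h9 | h9
  · obtain rfl : f = 9 := by omega
    exact a3h_9
  rcases Nat.lt_or_ge f 11 with h10 | h10
  · obtain rfl : f = 10 := by omega
    exact a3h_10
  rcases Nat.lt_or_ge f 12 with h11 | h11
  · obtain rfl : f = 11 := by omega
    exact a3h_11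
  rcases Nat.lt_or_ge f 13 with h12 | h12
  · obtain rfl : f = 12 := by omega
    exact a3h_12
  rcases Nat.lt_or_ge f 14 with h13 | h13
  · obtain rfl : f = 13 := by omega
    exact a3h_13
  rcases Nat.lt_or_ge f 15 with h14 | h14
  · obtain rfl : f = 14 := by omega
    exact a3h_14
  rcases Nat.lt_or_ge f 16 with h15 | h15
  · exact rows_sound _ a3_15 f (by omega) (by omega)
  rcases Nat.lt_or_ge f 17 with h16 | h16
  · exact rows_sound _ a3_16 f (by omega) (by omega)
  rcases Nat.lt_or_ge f 18 with h17 | h17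
  · exact rows_sound _ a3_17 f (by omega) (by omega)
  rcases Nat.lt_or_ge f 19 with h18 | h18
  · exact rows_sound _ a3_18 f (by omega) (by omega)
  rcases Nat.lt_or_ge f 20 with h19 | h19
  · exact rows_sound _ a3_19 f (by omega) (by omega)
  exact rows_sound _ a3_20 f (by omega) (by omega)

end Sky

theorem s_29 : s 29 = 14 := by
  exact Sky.final Sky.a2 Sky.a3 Sky.a4
end
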